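/- arXiv:1909.04264 — 8 statements merged into one kernel-verified Lean document; each statement's English description precedes it below -/
import Mathlib

section
/- Let n be a positive integer and ε > 0. If C is a set of vectors in (ZMod 2)^n (i.e. C ⊆ Fin n → ZMod 2) such that any two distinct elements x, y ∈ C satisfy hammingDist(x, y) > 2·n·(1/4 + ε), then the cardinality of C is at most 1 + 1/(4ε). -/
/-- **Plotkin bound.** If every pair of distinct codewords of a binary code
`C ⊆ (ZMod 2)^n` has Hamming distance greater than `2·n·(1/4 + ε)`, then
`|C| ≤ 1 + 1/(4ε)`. -/
theorem plotkin_bound (n : ℕ) (hn : 0 < n) (ε : ℝ) (hε : 0 < ε)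
    (C : Finset (Fin n → ZMod 2))
    (hdist : ∀ x ∈ C, ∀ y ∈ C, x ≠ y →
      2 * (n : ℝ) * (1 / 4 + ε) < (hammingDist x y : ℝ)) :
    (C.card : ℝ) ≤ 1 + 1 / (4 * ε) := by
  have hn' : (0 : ℝ) < n := by exact_mod_cast hn
  obtain ⟨s, hs⟩ : ∃ s : ZMod 2 → ℝ, ∀ a b, s a * s b = 1 - 2 * (if a ≠ b then 1 else 0) := by
    refine ⟨fun a => if a = 0 then 1 else -1, ?_⟩
    intro a b
    have hab : ∀ a b : ZMod 2, (a = 0 ∧ b = 0 ∧ a = b) ∨ (a = 0 ∧ b ≠ 0 ∧ a ≠ b) ∨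
        (a ≠ 0 ∧ b = 0 ∧ a ≠ b) ∨ (a ≠ 0 ∧ b ≠ 0 ∧ a = b) := by decide
    dsimp only
    rcases hab a b with h | h | h | h <;> obtain ⟨h1, h2, h3⟩ := h
    · rw [if_pos h1, if_pos h2, if_neg (not_not.mpr h3)]; norm_num
    · rw [if_pos h1, if_neg h2, if_pos h3]; norm_num
    · rw [if_neg h1, if_pos h2, if_pos h3]; norm_num
    · rw [if_neg h1, if_neg h2, if_neg (not_not.mpr h3)]; norm_num
  have key : ∀ x y : Fin n → ZMod 2,
      ∑ i, s (x i) * s (y i) = n - 2 * (hammingDist x y : ℝ) := by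
    intro x y
    simp only [hs, Finset.sum_sub_distrib, ← Finset.mul_sum, hammingDist, Finset.sum_boole]
    simp
  have h0 : 0 ≤ ∑ x ∈ C, ∑ y ∈ C, ∑ i, s (x i) * s (y i) := by
    have : ∑ x ∈ C, ∑ y ∈ C, ∑ i, s (x i) * s (y i) = ∑ i, (∑ x ∈ C, s (x i)) ^ 2 := by
      simp_rw [sq, Finset.sum_mul_sum]
      rw [Finset.sum_comm (s := Finset.univ)]
      refine Finset.sum_congr rfl fun x _ => ?_
      rw [Finset.sum_comm]
    rw [this]
    positivity
  have h1 : ∑ x ∈ C, ∑ y ∈ C, ∑ i, s (x i) * s (y i) ≤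
      ∑ x ∈ C, ∑ y ∈ C, (-(4 * n * ε) + if x = y then n + 4 * n * ε else 0) := by
    refine Finset.sum_le_sum fun x hx => Finset.sum_le_sum fun y hy => ?_
    rw [key]
    split_ifs with h
    · subst h
      simp
    · have := hdist x hx y hy h
      linarith
  have h2 : ∑ x ∈ C, ∑ y ∈ C, (-(4 * n * ε) + if x = y then n + 4 * n * ε else 0)
      = (C.card : ℝ) * n * (1 - 4 * ε * (C.card - 1)) := by
    have : ∀ x ∈ C, ∑ y ∈ C, (-(4 * n * ε) + if x = y then n + 4 * n * ε else 0)
        = (C.card : ℝ) * (-(4 * n * ε)) + (n + 4 * n * ε) := by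
      intro x hx
      rw [Finset.sum_add_distrib, Finset.sum_ite_eq, if_pos hx, Finset.sum_const, nsmul_eq_mul]
    rw [Finset.sum_congr rfl this, Finset.sum_const, nsmul_eq_mul]
    ring
  rcases Nat.eq_zero_or_pos C.card with h | h
  · rw [h]
    have : 0 < 1 / (4 * ε) := by positivity
    push_cast
    linarith
  · have hM : (0 : ℝ) < C.card * n := by
      have : (0 : ℝ) < C.card := by exact_mod_cast h
      positivity
    have h3 : 0 ≤ 1 - 4 * ε * ((C.card : ℝ) - 1) :=
      nonneg_of_mul_nonneg_right (by linarith) hM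
    have : (C.card : ℝ) - 1 ≤ 1 / (4 * ε) := by
      rw [le_div_iff₀ (by positivity)]
      linarith
    linarith
end

section
/- Let L be a positive integer and let p ∈ [1/2, 1]. For each sign vector x ∈ {−1, 1}^L, let w_p(x) = p^{m(x)}·(1−p)^{L−m(x)} where m(x) is the number of indices i with x_i = 1. Then ∑_{x ∈ {−1,1}^L} w_p(x)·|x_1 + ⋯ + x_L| ≥ 2^{−L} · ∑_{x ∈ {−1,1}^L} |x_1 + ⋯ + x_L|. In other words, the expected translation distance after L steps of a one-dimensional ±1 random walk with step-up probability p is minimized when p = 1/2. -/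
open Finset

lemma rw_key (p q : ℝ) (hq : 0 ≤ q) (hpq : q ≤ p) (a c d : ℕ) :
    p ^ (a + c) * q ^ (a + d) + q ^ (a + c) * p ^ (a + d) ≤
      p ^ a * q ^ (a + (c + d)) + q ^ a * p ^ (a + (c + d)) := by
  have h1 : q ^ c ≤ p ^ c := pow_le_pow_left₀ hq hpq c
  have h2 : q ^ d ≤ p ^ d := pow_le_pow_left₀ hq hpq d
  have hp : 0 ≤ p := hq.trans hpq
  have h3 : 0 ≤ (p ^ a * q ^ a) * ((p ^ c - q ^ c) * (p ^ d - q ^ d)) :=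
    mul_nonneg (by positivity) (mul_nonneg (by linarith) (by linarith))
  have : (p ^ a * q ^ (a + (c + d)) + q ^ a * p ^ (a + (c + d))) -
      (p ^ (a + c) * q ^ (a + d) + q ^ (a + c) * p ^ (a + d)) =
      (p ^ a * q ^ a) * ((p ^ c - q ^ c) * (p ^ d - q ^ d)) := by
    simp only [pow_add]; ring
  linarith

lemma rw_key2 (p q : ℝ) (hq : 0 ≤ q) (hpq : q ≤ p) (a b a' b' : ℕ) (h : a + b = a' + b')
    (h1 : a' ≤ a) (h2 : a' ≤ b) :
    p ^ a * q ^ b + q ^ a * p ^ b ≤ p ^ a' * q ^ b' + q ^ a' * p ^ b' := by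
  obtain ⟨c, rfl⟩ := Nat.exists_eq_add_of_le h1
  obtain ⟨d, rfl⟩ := Nat.exists_eq_add_of_le h2
  have : b' = a' + (c + d) := by omega
  subst this
  exact rw_key p q hq hpq a' c d

lemma rw_sum_eq (L : ℕ) (s : Fin L → Bool) :
    (∑ i, (if s i = true then (1 : ℝ) else -1)) =
      ((((Finset.univ.filter (fun i => s i = true)).card : ℤ) -
        ((L - (Finset.univ.filter (fun i => s i = true)).card : ℕ) : ℤ) : ℤ) : ℝ) := by
  have hle : (Finset.univ.filter (fun i => s i = true)).card ≤ L := by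
    simpa using Finset.card_le_univ (Finset.univ.filter (fun i => s i = true))
  have hc := Finset.card_filter_add_card_filter_not (s := (Finset.univ : Finset (Fin L)))
    (fun i => s i = true)
  rw [Finset.card_univ, Fintype.card_fin] at hc
  rw [Finset.sum_ite, Finset.sum_const, Finset.sum_const, ← Nat.eq_sub_of_add_eq' hc]
  push_cast
  simp
  ring

lemma rw_card_not (L : ℕ) (s : Fin L → Bool) :
    (Finset.univ.filter (fun i => (!s i) = true)).card =
      L - (Finset.univ.filter (fun i => s i = true)).card := by
  have hc := Finset.card_filter_add_card_filter_not (s := (Finset.univ : Finset (Fin L)))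
    (fun i => s i = true)
  rw [Finset.card_univ, Fintype.card_fin] at hc
  rw [← Nat.eq_sub_of_add_eq' hc]
  congr 1
  ext i
  simp

/-- The expected translation distance after `L` steps of a one-dimensional ±1 random
walk with step-up probability `p ∈ [1/2, 1]` is at least its value at `p = 1/2`:
`∑_{x ∈ {−1,1}^L} w_p(x)·|x_1 + ⋯ + x_L| ≥ 2^{−L} · ∑_{x ∈ {−1,1}^L} |x_1 + ⋯ + x_L|`,
where `w_p(x) = p^{m(x)}·(1−p)^{L−m(x)}` and `m(x)` is the number of `+1` steps. -/
theorem rw_translation_dist_min_at_half (L : ℕ) (hL : 0 < L) (p : ℝ)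
    (hp : 1 / 2 ≤ p) (hp1 : p ≤ 1) :
    (2 : ℝ) ^ (-(L : ℤ)) * ∑ s : Fin L → Bool, |∑ i, (if s i = true then (1 : ℝ) else -1)| ≤
      ∑ s : Fin L → Bool,
        (p ^ (Finset.univ.filter (fun i => s i = true)).card *
            (1 - p) ^ (L - (Finset.univ.filter (fun i => s i = true)).card)) *
          |∑ i, (if s i = true then (1 : ℝ) else -1)| := by
  set m : (Fin L → Bool) → ℕ := fun s => (Finset.univ.filter (fun i => s i = true)).card with hm
  set A : (Fin L → Bool) → ℝ := fun s => |∑ i, (if s i = true then (1 : ℝ) else -1)| with hA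
  have hle : ∀ s, m s ≤ L := fun s => by
    simpa using Finset.card_le_univ (Finset.univ.filter (fun i => s i = true))
  let e : (Fin L → Bool) ≃ (Fin L → Bool) :=
    ⟨fun s i => !s i, fun s i => !s i, fun s => by simp, fun s => by simp⟩
  have hme : ∀ s, m (e s) = L - m s := fun s => rw_card_not L s
  have hAm : ∀ s, A s = ((|(m s : ℤ) - ((L - m s : ℕ) : ℤ)| : ℤ) : ℝ) := fun s => by
    simp only [hA, hm]
    rw [rw_sum_eq, Int.cast_abs]
  have hAe : ∀ s, A (e s) = A s := fun s => by
    have := hle s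
    rw [hAm, hAm, hme, Nat.sub_sub_self this, abs_sub_comm]
  set g : (Fin L → Bool) → ℝ := fun s => p ^ m s * (1 - p) ^ (L - m s) with hg
  have hge : ∀ s, g (e s) = (1 - p) ^ m s * p ^ (L - m s) := fun s => by
    have := hle s
    simp only [hg]
    rw [hme, Nat.sub_sub_self this, mul_comm]
  have hmono : Monovary (fun s => g s + g (e s)) A := by
    intro s t hst
    rw [hAm, hAm, Int.cast_lt, abs_eq_max_neg, abs_eq_max_neg] at hst
    simp only [hge]
    simp only [hg]
    have h1 := hle s
    have h2 := hle t
    rcases le_total (m t) (L - m t) with h | h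
    · exact rw_key2 p (1 - p) (by linarith) (by linarith) _ _ _ _ (by omega)
        (by omega) (by omega)
    · have := rw_key2 p (1 - p) (by linarith) (by linarith) (m s) (L - m s) (L - m t) (m t)
        (by omega) (by omega) (by omega)
      linarith
  have hch := hmono.sum_mul_sum_le_card_mul_sum
  have hgsum : ∑ s, g s = 1 := by
    have := Finset.prod_univ_sum (fun _ : Fin L => (Finset.univ : Finset Bool))
      (fun _ b => if b = true then p else 1 - p)
    simp only [Fintype.sum_bool, if_true, Fintype.piFinset_univ] at this
    have h1 : (∏ _i : Fin L, (p + (if false = true then p else 1 - p))) = 1 := by simp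
    rw [h1] at this
    rw [this]
    refine Finset.sum_congr rfl fun s _ => ?_
    rw [Finset.prod_ite, Finset.prod_const, Finset.prod_const]
    have hc := Finset.card_filter_add_card_filter_not (s := (Finset.univ : Finset (Fin L)))
      (fun i => s i = true)
    rw [Finset.card_univ, Fintype.card_fin] at hc
    rw [Nat.eq_sub_of_add_eq' hc]
  have hgesum : ∑ s, g (e s) = 1 := by rw [Equiv.sum_comp e g, hgsum]
  have hgA : ∑ s, g (e s) * A s = ∑ s, g s * A s := by
    rw [← Equiv.sum_comp e (fun s => g s * A s)]
    simp only [hAe]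
  simp only [add_mul, Finset.sum_add_distrib, hgsum, hgesum, hgA] at hch
  have hcard : (Fintype.card (Fin L → Bool) : ℝ) = 2 ^ L := by simp
  rw [hcard] at hch
  rw [zpow_neg, zpow_natCast, inv_mul_le_iff₀ (by positivity)]
  linarith
end

section
/- Let X be a finite set, L ≥ 2 an integer, and P a probability distribution on Fin L → X with asymmetry asymm(P) = α. For each i ∈ {1,…,L−1}, let f_i : (Fin L → X) → ((Fin (L−1) → X) × (Fin (L−1) → X)) be the map sending (x_1,…,x_L) to the pair (y, z) where y = (x_1,…,x_{i−1}, x_i, x_{i+2},…,x_L) is x with its (i+1)-st coordinate deleted and z = (x_1,…,x_{i−1}, x_{i+1}, x_{i+2},…,x_L) is x with its i-th coordinate deleted, and let Q_i be the pushforward of P under f_i, i.e. Q_i(a,b) = ∑_{x : f_i(x) = (a,b)} P(x). Then there exists i ∈ {1,…,L−1} such that max_{(a,b)} |Q_i(a,b) − Q_i(b,a)| ≥ α / binom(L, 2). -/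
open Finset

/-- Delete the coordinate at (0-based) position `k` from a vector `x : Fin L → X`,
yielding a vector in `Fin (L-1) → X`. -/
def delCoord {X : Type*} {L : ℕ} (k : ℕ) (x : Fin L → X) : Fin (L - 1) → X :=
  fun l =>
    if l.val < k then x ⟨l.val, by have := l.isLt; omega⟩
    else x ⟨l.val + 1, by have := l.isLt; omega⟩

lemma asymm_insert_step {X : Type*} {n : ℕ} (k : ℕ) (h : k + 1 < n + 1) (x : X) (c : Fin n → X) :
    (Fin.insertNth (α := fun _ => X) ⟨k + 1, h⟩ x c : Fin (n + 1) → X) =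
      (Fin.insertNth (α := fun _ => X) ⟨k, by omega⟩ x c : Fin (n + 1) → X) ∘
        Equiv.swap (⟨k, by omega⟩ : Fin (n + 1)) ⟨k + 1, h⟩ := by
  symm
  rw [Fin.eq_insertNth_iff]
  constructor
  · simp
  · ext1 j
    have : Equiv.swap (⟨k, by omega⟩ : Fin (n + 1)) ⟨k + 1, h⟩
        (Fin.succAbove ⟨k + 1, h⟩ j) = Fin.succAbove ⟨k, by omega⟩ j := by
      rw [Equiv.swap_apply_def]
      simp only [Fin.succAbove, Fin.lt_def, Fin.ext_iff]
      split_ifs <;> simp_all <;> omega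
    simp only [Fin.removeNth, Function.comp_apply]
    rw [this]
    simp

lemma asymm_insert_bound {X : Type*} {n : ℕ} (P : (Fin (n + 1) → X) → ℝ) (D : ℝ)
    (h : ∀ (i : ℕ) (hi : i + 1 < n + 1) (x : Fin (n + 1) → X),
      |P x - P (x ∘ Equiv.swap ⟨i, by omega⟩ ⟨i + 1, hi⟩)| ≤ D)
    (x : X) (c : Fin n → X) (k : ℕ) (hk : k < n + 1) :
    |P (Fin.insertNth (α := fun _ => X) ⟨k, hk⟩ x c) - P (Fin.cons (α := fun _ => X) x c)|
      ≤ k * D := by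
  induction k with
  | zero =>
    have : (⟨0, hk⟩ : Fin (n + 1)) = 0 := rfl
    rw [this, Fin.insertNth_zero']
    simp
  | succ k ih =>
    have h1 := ih (by omega)
    have h2 := h k hk (Fin.insertNth (α := fun _ => X) ⟨k, by omega⟩ x c)
    rw [← asymm_insert_step] at h2
    rw [abs_le] at *
    push_cast
    constructor <;> linarith [h1.1, h1.2, h2.1, h2.2]

lemma asymm_perm_bound {X : Type*} (D : ℝ) (hD : 0 ≤ D) (n : ℕ) (P : (Fin n → X) → ℝ)
    (h : ∀ (i : ℕ) (hi : i + 1 < n) (x : Fin n → X),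
      |P x - P (x ∘ Equiv.swap ⟨i, by omega⟩ ⟨i + 1, hi⟩)| ≤ D)
    (a : Fin n → X) (σ : Equiv.Perm (Fin n)) :
    |P a - P (a ∘ σ)| ≤ (n.choose 2 : ℝ) * D := by
  induction n with
  | zero =>
    have : a ∘ σ = a := Subsingleton.elim _ _
    simp [this]
  | succ n ih =>
    have hne : ∀ j : Fin n, ∃ t : Fin n, (σ 0).succAbove t = σ j.succ := by
      intro j
      apply Fin.exists_succAbove_eq
      intro e
      exact Fin.succ_ne_zero j (σ.injective e)
    choose t ht using hne
    have tinj : Function.Injective t := by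
      intro i j e
      have := ht i
      rw [e, ht j] at this
      exact (Fin.succ_injective _ (σ.injective this)).symm
    let τ : Equiv.Perm (Fin n) := Equiv.ofBijective t (Finite.injective_iff_bijective.1 tinj)
    have hτ : ∀ j, τ j = t j := fun j => rfl
    set c : Fin n → X := Fin.removeNth (α := fun _ => X) (σ 0) a with hc
    have e1 : a = Fin.insertNth (α := fun _ => X) (σ 0) (a (σ 0)) c := by
      rw [Fin.eq_insertNth_iff]
      exact ⟨rfl, rfl⟩
    have e2 : a ∘ σ = Fin.cons (α := fun _ => X) (a (σ 0)) (c ∘ τ) := by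
      ext1 j
      refine Fin.cases ?_ (fun j => ?_) j
      · simp
      · simp [hc, Fin.removeNth, hτ, ht]
    have b1 := asymm_insert_bound P D h (a (σ 0)) c (σ 0).val (σ 0).isLt
    have b2 := ih (fun c => P (Fin.cons (α := fun _ => X) (a (σ 0)) c)) (by
      intro i hi x
      have := h (i + 1) (by omega) (Fin.cons (α := fun _ => X) (a (σ 0)) x)
      convert this using 4
      ext1 j
      refine Fin.cases ?_ (fun j => ?_) j
      · rw [Function.comp_apply, Equiv.swap_apply_of_ne_of_ne]
        · simp
        · simp [Fin.ext_iff]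
        · simp [Fin.ext_iff]
      · have : Equiv.swap (⟨i + 1, by omega⟩ : Fin (n + 1)) ⟨i + 1 + 1, by omega⟩ j.succ
            = (Equiv.swap (⟨i, by omega⟩ : Fin n) ⟨i + 1, hi⟩ j).succ := by
          exact ((Fin.succ_injective n).map_swap ⟨i, by omega⟩ ⟨i + 1, hi⟩ j).symm
        rw [Function.comp_apply, this]
        simp) c τ
    have b3 : ((σ 0).val : ℝ) * D ≤ n * D := by
      apply mul_le_mul_of_nonneg_right _ hD
      exact_mod_cast Nat.lt_succ_iff.1 (σ 0).isLt
    have b4 : (((n + 1).choose 2 : ℕ) : ℝ) = n + (n.choose 2 : ℝ) := by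
      rw [Nat.choose_succ_succ' n 1]
      simp
    rw [Fin.eta, ← e1] at b1
    rw [← e2] at b2
    rw [b4]
    rw [abs_le] at *
    constructor <;> nlinarith [b1.1, b1.2, b2.1, b2.2]

lemma asymm_delCoord_inj {X : Type*} {L : ℕ} (i : ℕ) (hi : i + 1 < L) (x y : Fin L → X)
    (h1 : delCoord (i + 1) x = delCoord (i + 1) y) (h2 : delCoord i x = delCoord i y) :
    x = y := by
  ext1 ⟨j, hj⟩
  rcases lt_trichotomy j (i + 1) with h | h | h
  · have := congrFun h1 ⟨j, by omega⟩
    simpa [delCoord, h] using this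
  · subst h
    have := congrFun h2 ⟨i, by omega⟩
    simpa [delCoord] using this
  · obtain ⟨j, rfl⟩ : ∃ k, j = k + 1 := ⟨j - 1, by omega⟩
    have := congrFun h1 ⟨j, by omega⟩
    simpa [delCoord, show ¬ j < i + 1 by omega] using this

lemma asymm_delCoord_swap {X : Type*} {L : ℕ} (i : ℕ) (hi : i + 1 < L) (x : Fin L → X) :
    delCoord (i + 1) (x ∘ Equiv.swap (⟨i, by omega⟩ : Fin L) ⟨i + 1, hi⟩) = delCoord i x := by
  ext1 ⟨j, hj⟩
  simp only [delCoord, Function.comp_apply, Equiv.swap_apply_def, Fin.ext_iff]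
  rcases lt_trichotomy j i with h | h | h
  · simp [h, show j < i + 1 by omega, show j ≠ i by omega, show j ≠ i + 1 by omega]
  · simp [h]
  · simp [show ¬ j < i by omega, show ¬ j < i + 1 by omega, show j ≠ i by omega,
      show j + 1 ≠ i by omega]

lemma asymm_delCoord_swap' {X : Type*} {L : ℕ} (i : ℕ) (hi : i + 1 < L) (x : Fin L → X) :
    delCoord i (x ∘ Equiv.swap (⟨i, by omega⟩ : Fin L) ⟨i + 1, hi⟩) = delCoord (i + 1) x := by
  rw [← asymm_delCoord_swap i hi (x ∘ Equiv.swap (⟨i, by omega⟩ : Fin L) ⟨i + 1, hi⟩)]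
  congr 1
  ext1 j
  simp

/-- **Reduction of asymmetry to pairs.** Let `P` be a probability distribution on
`Fin L → X` with asymmetry exactly `α`. For `1 ≤ i ≤ L−1`, let `Q_i` be the
pushforward of `P` under the map sending `x` to the pair consisting of `x` with its
`(i+1)`-st coordinate deleted and `x` with its `i`-th coordinate deleted (1-based).
Then some `Q_i` has asymmetry at least `α / binom(L, 2)`. -/
theorem asymmetry_marginal_reduction {X : Type*} [Fintype X] [DecidableEq X]
    (L : ℕ) (hL : 2 ≤ L)
    (P : (Fin L → X) → ℝ) (hP0 : ∀ x, 0 ≤ P x) (hP1 : ∑ x, P x = 1)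
    (α : ℝ)
    (hub : ∀ (a : Fin L → X) (σ : Equiv.Perm (Fin L)), |P a - P (a ∘ σ)| ≤ α)
    (hattain : ∃ (a : Fin L → X) (σ : Equiv.Perm (Fin L)), |P a - P (a ∘ σ)| = α) :
    ∃ i : ℕ, 1 ≤ i ∧ i ≤ L - 1 ∧
      ∃ a b : Fin (L - 1) → X,
        α / (Nat.choose L 2 : ℝ) ≤
          |(∑ x ∈ Finset.univ.filter
              (fun x : Fin L → X => delCoord i x = a ∧ delCoord (i - 1) x = b), P x) -
            (∑ x ∈ Finset.univ.filter
              (fun x : Fin L → X => delCoord i x = b ∧ delCoord (i - 1) x = a), P x)| := by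
  obtain ⟨a, σ, hα⟩ := hattain
  have : Nonempty (Fin (L - 1) × (Fin L → X)) := ⟨(⟨0, by omega⟩, a)⟩
  obtain ⟨⟨i, x⟩, hmax⟩ := Finite.exists_max (fun p : Fin (L - 1) × (Fin L → X) =>
    |P p.2 - P (p.2 ∘ Equiv.swap (⟨p.1.val, by omega⟩ : Fin L) ⟨p.1.val + 1, by omega⟩)|)
  have hi : i.val + 1 < L := by omega
  have key := asymm_perm_bound _ (abs_nonneg _) L P
    (fun j hj y => hmax (⟨j, by omega⟩, y)) a σ
  rw [hα] at key
  refine ⟨i.val + 1, by omega, by omega, delCoord (i.val + 1) x, delCoord i.val x, ?_⟩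
  have hpos : (0 : ℝ) < (L.choose 2 : ℝ) := by exact_mod_cast Nat.choose_pos hL
  have f1 : Finset.univ.filter (fun y : Fin L → X => delCoord (i.val + 1) y =
      delCoord (i.val + 1) x ∧ delCoord (i.val + 1 - 1) y = delCoord i.val x) = {x} := by
    ext y
    simp only [Finset.mem_filter, Finset.mem_univ, true_and, Finset.mem_singleton,
      Nat.add_sub_cancel]
    constructor
    · rintro ⟨h1, h2⟩
      exact asymm_delCoord_inj i.val hi _ _ h1 h2
    · rintro rfl
      exact ⟨rfl, rfl⟩
  have f2 : Finset.univ.filter (fun y : Fin L → X => delCoord (i.val + 1) y =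
      delCoord i.val x ∧ delCoord (i.val + 1 - 1) y = delCoord (i.val + 1) x) =
      {x ∘ Equiv.swap (⟨i.val, by omega⟩ : Fin L) ⟨i.val + 1, hi⟩} := by
    ext y
    simp only [Finset.mem_filter, Finset.mem_univ, true_and, Finset.mem_singleton,
      Nat.add_sub_cancel]
    constructor
    · rintro ⟨h1, h2⟩
      apply asymm_delCoord_inj i.val hi
      · rw [h1, asymm_delCoord_swap]
      · rw [h2, asymm_delCoord_swap']
    · rintro rfl
      exact ⟨asymm_delCoord_swap _ hi _, asymm_delCoord_swap' _ hi _⟩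
  rw [f1, f2, Finset.sum_singleton, Finset.sum_singleton, div_le_iff₀ hpos, mul_comm]
  exact key
end

section
/- Let X be a nonempty finite set, L ≥ 2 and n, M positive integers. Let P̂ be a probability distribution on Fin L → X and Q : (Fin L → X) → ℝ a copositive tensor with Frobenius norm (∑_a Q(a)²)^{1/2} = 1 satisfying ⟨P̂, Q⟩ ≤ −η for some η > 0. Let ζ be a real with 0 ≤ ζ ≤ η/(2·|X|^L). Suppose x : Fin M → (Fin n → X) is an injective family of codewords such that for every injective i : Fin L → Fin M, the joint type τ_{x(i(1)),…,x(i(L))} satisfies ∑_{a ∈ X^L} |τ(a) − P̂(a)| ≤ ζ. Then M ≤ max(2·(L−1), 2^{L+1}·L! / η). -/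
open Finset

lemma aux_tot {X : Type*} [Fintype X] [DecidableEq X] (L M : ℕ) (Q : (Fin L → X) → ℝ)
    (y : Fin M → X) :
    ∑ i : Fin L → Fin M, Q (fun l => y (i l)) =
      ∑ a : Fin L → X, Q a * ∏ l, (∑ m : Fin M, if y m = a l then (1 : ℝ) else 0) := by
  have h : ∀ a : Fin L → X, ∏ l, (∑ m : Fin M, if y m = a l then (1 : ℝ) else 0)
      = ∑ i : Fin L → Fin M, if (fun l => y (i l)) = a then (1 : ℝ) else 0 := by
    intro a
    rw [Fintype.prod_sum]
    refine Finset.sum_congr rfl fun i _ => ?_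
    rw [Finset.prod_ite_zero]
    simp [funext_iff]
  simp_rw [h, Finset.mul_sum]
  rw [Finset.sum_comm]
  simp

lemma aux_type {X : Type*} [Fintype X] [DecidableEq X] (L n : ℕ) (Q : (Fin L → X) → ℝ)
    (z : Fin L → Fin n → X) :
    ∑ a : Fin L → X, ((Finset.univ.filter fun j : Fin n => ∀ l, z l j = a l).card : ℝ) / (n : ℝ)
      * Q a = (∑ j, Q (fun l => z l j)) / n := by
  have h : ∀ a : Fin L → X, ((Finset.univ.filter fun j : Fin n => ∀ l, z l j = a l).card : ℝ)
      = ∑ j, if (fun l => z l j) = a then (1 : ℝ) else 0 := by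
    intro a
    simp [funext_iff]
  simp_rw [h, div_mul_eq_mul_div]
  rw [← Finset.sum_div]
  simp_rw [Finset.sum_mul]
  rw [Finset.sum_comm]
  simp

lemma aux_card (L M : ℕ) :
    (Finset.univ.filter fun i : Fin L → Fin M => Function.Injective i).card
      = M.descFactorial L := by
  rw [← Fintype.card_subtype, Fintype.card_congr (Equiv.subtypeInjectiveEquivEmbedding _ _),
    Fintype.card_embedding_eq]
  simp

lemma aux_desc (M L : ℕ) :
    (M : ℝ) ^ (L + 1) ≤ M * (M.descFactorial L : ℝ) + (L : ℝ) * (L - 1) / 2 * (M : ℝ) ^ L := by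
  induction L with
  | zero => simp
  | succ k ih =>
    rw [Nat.descFactorial_succ]
    have h1 : (M : ℝ) - k ≤ ((M - k : ℕ) : ℝ) := by
      have : M ≤ (M - k) + k := by omega
      have : (M : ℝ) ≤ ((M - k : ℕ) : ℝ) + k := by exact_mod_cast this
      linarith
    have h2 : (M.descFactorial k : ℝ) ≤ (M : ℝ) ^ k := by
      exact_mod_cast Nat.descFactorial_le_pow M k
    have hM : (0 : ℝ) ≤ M := Nat.cast_nonneg _
    have hk : (0 : ℝ) ≤ k := Nat.cast_nonneg _
    have hD : (0 : ℝ) ≤ (M.descFactorial k : ℝ) := Nat.cast_nonneg _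
    push_cast
    have h3 := mul_le_mul_of_nonneg_left (mul_le_mul_of_nonneg_right h1 hD) hM
    have h4 := mul_le_mul_of_nonneg_left h2 (mul_nonneg hM hk)
    have h5 := mul_le_mul_of_nonneg_left ih hM
    simp only [pow_succ] at *
    nlinarith

lemma aux_fact (L : ℕ) : (L : ℝ) * (L - 1) / 2 ≤ (L.factorial : ℝ) := by
  rcases L with _ | _ | k
  · simp
  · simp
  · have h : 1 ≤ k.factorial := Nat.factorial_pos k
    have h' : (1 : ℝ) ≤ k.factorial := by exact_mod_cast h
    rw [Nat.factorial_succ, Nat.factorial_succ]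
    push_cast
    have hk : (0 : ℝ) ≤ k := Nat.cast_nonneg _
    have : 0 ≤ ((k : ℝ) + 1 + 1) * (k + 1) := by positivity
    nlinarith

/-- **Plotkin-type converse, symmetric case.** Suppose `P̂` is a distribution on
`Fin L → X`, `Q` is a copositive tensor of Frobenius norm 1 with `⟨P̂, Q⟩ ≤ −η`,
and `0 ≤ ζ ≤ η/(2·|X|^L)`. Then any injective family of `M` codewords in `X^n`
all of whose ordered `L`-tuples of distinct codewords have joint type within
ℓ1-distance `ζ` of `P̂` satisfies `M ≤ max(2(L−1), 2^{L+1}·L!/η)`. -/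
theorem converse_symmetric_case {X : Type*} [Fintype X] [Nonempty X] [DecidableEq X]
    (L n M : ℕ) (hL : 2 ≤ L) (hn : 0 < n) (hM : 0 < M)
    (Phat : (Fin L → X) → ℝ) (hP0 : ∀ a, 0 ≤ Phat a) (hP1 : ∑ a, Phat a = 1)
    (Q : (Fin L → X) → ℝ)
    (hQcop : ∀ u : X → ℝ, (∀ a, 0 ≤ u a) →
      0 ≤ ∑ a : Fin L → X, Q a * ∏ l, u (a l))
    (hQnorm : Real.sqrt (∑ a : Fin L → X, (Q a) ^ 2) = 1)
    (η : ℝ) (hη : 0 < η)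
    (hPQ : ∑ a : Fin L → X, Phat a * Q a ≤ -η)
    (ζ : ℝ) (hζ0 : 0 ≤ ζ) (hζ : ζ ≤ η / (2 * (Fintype.card X : ℝ) ^ L))
    (x : Fin M → (Fin n → X)) (hx : Function.Injective x)
    (hequi : ∀ i : Fin L → Fin M, Function.Injective i →
      ∑ a : Fin L → X,
        |((Finset.univ.filter fun j : Fin n => ∀ l, x (i l) j = a l).card : ℝ) / (n : ℝ)
          - Phat a| ≤ ζ) :
    (M : ℝ) ≤ max (2 * ((L : ℝ) - 1)) (2 ^ (L + 1) * (Nat.factorial L : ℝ) / η) := by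
  classical
  have hn' : (0 : ℝ) < n := by exact_mod_cast hn
  have hM' : (0 : ℝ) < M := by exact_mod_cast hM
  have hQ1 : ∀ a, |Q a| ≤ 1 := by
    intro a
    rw [Real.sqrt_eq_one] at hQnorm
    have : Q a ^ 2 ≤ 1 := by
      rw [← hQnorm]
      exact Finset.single_le_sum (f := fun a => Q a ^ 2) (fun i _ => sq_nonneg _)
        (Finset.mem_univ a)
    exact (sq_le_one_iff_abs_le_one _).1 this
  have hζ2 : ζ ≤ η / 2 := by
    refine hζ.trans ?_
    have hc : (1 : ℝ) ≤ (Fintype.card X : ℝ) ^ L := by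
      apply one_le_pow₀
      exact_mod_cast Fintype.card_pos
    apply div_le_div_of_nonneg_left hη.le (by norm_num)
    linarith
  let f : (Fin L → Fin M) → ℝ := fun i => (∑ j, Q (fun l => x (i l) j)) / n
  have htot : 0 ≤ ∑ i, f i := by
    simp only [f]
    rw [← Finset.sum_div, Finset.sum_comm]
    refine div_nonneg (Finset.sum_nonneg fun j _ => ?_) hn'.le
    rw [aux_tot L M Q (fun m => x m j)]
    exact hQcop (fun b => ∑ m : Fin M, if x m j = b then (1 : ℝ) else 0)
      (fun b => Finset.sum_nonneg fun m _ => by split_ifs <;> norm_num)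
  have hinj : ∀ i, Function.Injective i → f i ≤ -(η / 2) := by
    intro i hi
    have h := hequi i hi
    simp only [f]
    rw [← aux_type L n Q (fun l => x (i l))]
    have h2 : ∑ a : Fin L → X,
        (((Finset.univ.filter fun j : Fin n => ∀ l, x (i l) j = a l).card : ℝ) / (n : ℝ)
          - Phat a) * Q a ≤ ζ := by
      refine le_trans (Finset.sum_le_sum fun a _ => ?_) h
      refine (le_abs_self _).trans ?_
      rw [abs_mul]
      exact mul_le_of_le_one_right (abs_nonneg _) (hQ1 a)
    simp_rw [sub_mul] at h2
    rw [Finset.sum_sub_distrib] at h2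
    linarith
  have hle : ∀ i, f i ≤ 1 := by
    intro i
    simp only [f]
    rw [div_le_one hn']
    calc ∑ j, Q (fun l => x (i l) j) ≤ ∑ j : Fin n, (1 : ℝ) :=
          Finset.sum_le_sum fun j _ => (le_abs_self _).trans (hQ1 _)
      _ = n := by simp
  have hkey : (0 : ℝ) ≤ (M : ℝ) ^ L - (1 + η / 2) * (M.descFactorial L : ℝ) := by
    calc (0 : ℝ) ≤ ∑ i, f i := htot
      _ ≤ ∑ i : Fin L → Fin M, (1 - (1 + η / 2) * if Function.Injective i then (1 : ℝ) else 0) := by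
          refine Finset.sum_le_sum fun i _ => ?_
          split_ifs with hi
          · linarith [hinj i hi]
          · linarith [hle i]
      _ = _ := by
          rw [Finset.sum_sub_distrib, ← Finset.mul_sum, ← aux_card L M]
          simp
  by_contra hcon
  rw [not_le, max_lt_iff] at hcon
  obtain ⟨hc1, hc2⟩ := hcon
  have hlow : ((M : ℝ) / 2) ^ L ≤ (M.descFactorial L : ℝ) := by
    have h1 : ((M + 1 - L : ℕ) : ℝ) ^ L ≤ (M.descFactorial L : ℝ) := by
      exact_mod_cast Nat.pow_sub_le_descFactorial M L
    refine le_trans (pow_le_pow_left₀ (by positivity) ?_ L) h1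
    have : M + 1 ≤ (M + 1 - L) + L := by omega
    have : (M : ℝ) + 1 ≤ ((M + 1 - L : ℕ) : ℝ) + L := by exact_mod_cast this
    linarith
  rw [div_lt_iff₀ hη] at hc2
  have hd := aux_desc M L
  have hf := aux_fact L
  have hp : (0 : ℝ) < (M : ℝ) ^ L := by positivity
  have h1 : η / 2 * (M * (M.descFactorial L : ℝ)) ≤ (L.factorial : ℝ) * (M : ℝ) ^ L := by
    have e1 := mul_nonneg hM'.le hkey
    have e2 := mul_le_mul_of_nonneg_right hf hp.le
    rw [pow_succ] at hd
    nlinarith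
  have h2 : η / 2 * (M * ((M : ℝ) / 2) ^ L) ≤ (L.factorial : ℝ) * (M : ℝ) ^ L :=
    le_trans (by gcongr) h1
  have h3 : M * η * (M : ℝ) ^ L ≤ 2 ^ (L + 1) * (L.factorial : ℝ) * (M : ℝ) ^ L := by
    have e := mul_le_mul_of_nonneg_left h2 (show (0 : ℝ) ≤ 2 ^ (L + 1) by positivity)
    calc M * η * (M : ℝ) ^ L = 2 ^ (L + 1) * (η / 2 * (M * ((M : ℝ) / 2) ^ L)) := by
          rw [div_pow, pow_succ]
          field_simp
      _ ≤ _ := e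
      _ = _ := by ring
  have h4 := le_of_mul_le_mul_right h3 hp
  linarith
end

section
/- Let X be a nonempty finite set, L a positive integer, ζ > 0, and M a positive integer. Then there exists a positive integer N such that for every positive integer n and every set C ⊆ (Fin n → X) with |C| ≥ N, there exist M distinct codewords x_1, …, x_M ∈ C and a probability distribution P̂ on Fin L → X such that for every choice of indices 1 ≤ i_1 < i_2 < ⋯ < i_L ≤ M, the joint type of (x_{i_1}, …, x_{i_L}) satisfies ∑_{a ∈ X^L} |τ_{x_{i_1},…,x_{i_L}}(a) − P̂(a)| ≤ ζ. (Every sufficiently large code contains an M-element (ζ, P̂)-equicoupled subcode for some distribution P̂; crucially, N does not depend on the blocklength n.) -/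
open Finset

/-- Ramsey property for `L`-subsets with colours in `K` and target size `M`. -/
def RamseyAt (L : ℕ) (K : Type*) (M : ℕ) : Prop :=
  ∃ N : ℕ, ∀ (α : Type) [LinearOrder α] (c : Finset α → K) (S : Finset α), N ≤ S.card →
    ∃ T ⊆ S, T.card = M ∧ ∃ k : K, ∀ s ⊆ T, s.card = L → c s = k

/-- The version where the colour depends only on the minimum of the set. -/
theorem ramsey_min {L : ℕ} {K : Type*} [Nonempty K] (h : ∀ M, RamseyAt L K M) (m : ℕ) :
    ∃ N : ℕ, ∀ (α : Type) [LinearOrder α] (c : Finset α → K) (S : Finset α), N ≤ S.card →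
      ∃ T ⊆ S, T.card = m ∧ ∃ f : α → K, ∀ x ∈ T, ∀ s ⊆ T, (∀ y ∈ s, x < y) →
        s.card = L → c (insert x s) = f x := by
  induction m with
  | zero =>
    refine ⟨0, fun α _ c S _ => ⟨∅, by simp, by simp, fun _ => Classical.arbitrary K, by simp⟩⟩
  | succ m ih =>
    obtain ⟨N₁, h₁⟩ := ih
    obtain ⟨N₂, h₂⟩ := h N₁
    refine ⟨N₂ + 1, fun α _ c S hS => ?_⟩
    have hne : S.Nonempty := Finset.card_pos.mp (by omega)
    set x := S.min' hne with hx
    have hxS : x ∈ S := S.min'_mem hne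
    have hlt : ∀ y ∈ S.erase x, x < y := fun y hy => by
      have h1 := S.min'_le y (Finset.mem_of_mem_erase hy)
      exact lt_of_le_of_ne h1 (Ne.symm (Finset.ne_of_mem_erase hy))
    obtain ⟨S', hS', hc', k, hk⟩ := h₂ α (fun s => c (insert x s)) (S.erase x)
      (by rw [Finset.card_erase_of_mem hxS]; omega)
    obtain ⟨T, hT, hTc, f, hf⟩ := h₁ α c S' (by omega)
    have hTlt : ∀ y ∈ T, x < y := fun y hy => hlt y (hS' (hT hy))
    have hxT : x ∉ T := fun hh => lt_irrefl _ (hTlt x hh)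
    refine ⟨insert x T, ?_, by rw [Finset.card_insert_of_notMem hxT, hTc],
      Function.update f x k, ?_⟩
    · intro y hy
      rcases Finset.mem_insert.mp hy with rfl | hy
      · exact hxS
      · exact Finset.mem_of_mem_erase (hS' (hT hy))
    · intro z hz s hs hzs hsL
      have hsT : s ⊆ T := by
        intro y hy
        rcases Finset.mem_insert.mp (hs hy) with hyx | hyT
        · exfalso
          have h1 := hzs y hy
          rw [hyx] at h1
          rcases Finset.mem_insert.mp hz with hzx | hzT
          · rw [hzx] at h1
            exact lt_irrefl _ h1
          · exact lt_asymm h1 (hTlt z hzT)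
        · exact hyT
      rcases Finset.mem_insert.mp hz with hzx | hzT
      · rw [hzx, Function.update_self]
        exact hk s (hsT.trans hT) hsL
      · have hne' : z ≠ x := fun hh => hxT (hh ▸ hzT)
        rw [Function.update_of_ne hne']
        exact hf z hzT s hsT hzs hsL

theorem ramsey_all (L : ℕ) (K : Type*) [Nonempty K] [Fintype K] : ∀ M, RamseyAt L K M := by
  classical
  induction L with
  | zero =>
    intro M
    refine ⟨M, fun α _ c S hS => ?_⟩
    obtain ⟨T, hT, hTc⟩ := Finset.exists_subset_card_eq hS
    refine ⟨T, hT, hTc, c ∅, fun s _ hs0 => ?_⟩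
    rw [Finset.card_eq_zero.mp hs0]
  | succ L ih =>
    intro M
    obtain ⟨N, hN⟩ := ramsey_min ih (Fintype.card K * M)
    refine ⟨N, fun α _ c S hS => ?_⟩
    obtain ⟨T, hT, hTc, f, hf⟩ := hN α c S hS
    obtain ⟨k, -, hk⟩ := Finset.exists_le_card_fiber_of_mul_le_card_of_maps_to
      (s := T) (t := (Finset.univ : Finset K)) (f := f) (n := M) (fun _ _ => Finset.mem_univ _)
      Finset.univ_nonempty (by rw [Finset.card_univ, hTc])
    obtain ⟨U, hU, hUc⟩ := Finset.exists_subset_card_eq hk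
    have hUT : U ⊆ T := hU.trans (Finset.filter_subset _ _)
    refine ⟨U, hUT.trans hT, hUc, k, fun s hs hsc => ?_⟩
    have hne : s.Nonempty := Finset.card_pos.mp (by omega)
    have hm : s.min' hne ∈ s := s.min'_mem hne
    have h1 := hf (s.min' hne) (hUT (hs hm)) (s.erase (s.min' hne))
      ((Finset.erase_subset _ _).trans (hs.trans hUT))
      (fun y hy => lt_of_le_of_ne (s.min'_le y (Finset.mem_of_mem_erase hy))
        (Ne.symm (Finset.ne_of_mem_erase hy)))
      (by rw [Finset.card_erase_of_mem hm]; omega)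
    rw [Finset.insert_erase hm] at h1
    rw [h1]
    exact (Finset.mem_filter.mp (hU (hs hm))).2

/-- The joint type of an `L`-tuple. -/
noncomputable def jtype {X : Type*} [DecidableEq X] {L n : ℕ} (y : Fin L → Fin n → X)
    (a : Fin L → X) : ℝ :=
  ((Finset.univ.filter fun j : Fin n => ∀ l, y l j = a l).card : ℝ) / (n : ℝ)

theorem jtype_nonneg {X : Type*} [DecidableEq X] {L n : ℕ} (y : Fin L → Fin n → X)
    (a : Fin L → X) : 0 ≤ jtype y a := by
  unfold jtype; positivity

theorem jtype_sum {X : Type*} [Fintype X] [DecidableEq X] {L n : ℕ} (hn : 0 < n)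
    (y : Fin L → Fin n → X) : ∑ a, jtype y a = 1 := by
  unfold jtype
  rw [← Finset.sum_div, ← Nat.cast_sum]
  have h := Finset.card_eq_sum_card_fiberwise (s := (Finset.univ : Finset (Fin n)))
    (t := (Finset.univ : Finset (Fin L → X))) (f := fun j l => y l j)
    (fun _ _ => Finset.mem_coe.mpr (Finset.mem_univ _))
  simp only [funext_iff, Finset.card_univ, Fintype.card_fin] at h
  rw [← h]
  have : (n : ℝ) ≠ 0 := by positivity
  exact div_self this

theorem jtype_le_one {X : Type*} [DecidableEq X] {L n : ℕ} (y : Fin L → Fin n → X)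
    (a : Fin L → X) : jtype y a ≤ 1 := by
  unfold jtype
  apply div_le_one_of_le₀ _ (by positivity)
  exact_mod_cast (Finset.card_le_univ _).trans (by simp)

/-- Quantised joint type. -/
noncomputable def qtype {X : Type*} [DecidableEq X] {L n : ℕ} (Q : ℕ) (y : Fin L → Fin n → X)
    (a : Fin L → X) : Fin (Q + 1) :=
  ⟨⌊jtype y a * Q⌋₊, by
    have h : jtype y a * Q ≤ Q := mul_le_of_le_one_left (by positivity) (jtype_le_one y a)
    exact Nat.lt_succ_of_le (Nat.floor_le_of_le h)⟩

theorem qtype_close {X : Type*} [DecidableEq X] {L n : ℕ} {Q : ℕ} (hQ : 0 < Q)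
    (y z : Fin L → Fin n → X) (h : qtype Q y = qtype Q z) (a : Fin L → X) :
    |jtype y a - jtype z a| ≤ 1 / Q := by
  have h1 : ⌊jtype y a * Q⌋₊ = ⌊jtype z a * Q⌋₊ := congrArg Fin.val (congrFun h a)
  have hQ' : (0 : ℝ) < Q := by exact_mod_cast hQ
  have a1 := Nat.floor_le (mul_nonneg (jtype_nonneg y a) hQ'.le)
  have a2 := Nat.floor_le (mul_nonneg (jtype_nonneg z a) hQ'.le)
  have b1 := Nat.lt_floor_add_one (jtype y a * Q)
  have b2 := Nat.lt_floor_add_one (jtype z a * Q)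
  rw [h1] at a1 b1
  rw [le_div_iff₀ hQ', ← abs_of_pos hQ', ← abs_mul, abs_le]
  constructor <;> nlinarith

/-- **Equicoupled subcode extraction.** For every finite alphabet `X`, order `L`,
tolerance `ζ > 0` and target size `M`, there is a threshold `N` (independent of the
blocklength `n`) such that every code `C ⊆ X^n` with `|C| ≥ N` contains `M`
distinct codewords all of whose ascending `L`-tuples have joint type within
ℓ1-distance `ζ` of a common distribution `P̂` on `Fin L → X`. -/
theorem equicoupled_subcode_extraction {X : Type*} [Fintype X] [Nonempty X] [DecidableEq X]
    (L : ℕ) (hL : 0 < L) (ζ : ℝ) (hζ : 0 < ζ) (M : ℕ) (hM : 0 < M) :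
    ∃ N : ℕ, 0 < N ∧
      ∀ n : ℕ, 0 < n → ∀ C : Finset (Fin n → X), N ≤ C.card →
        ∃ x : Fin M → (Fin n → X), Function.Injective x ∧ (∀ m, x m ∈ C) ∧
          ∃ Phat : (Fin L → X) → ℝ, (∀ a, 0 ≤ Phat a) ∧ (∑ a, Phat a = 1) ∧
            ∀ i : Fin L → Fin M, StrictMono i →
              ∑ a : Fin L → X,
                |((Finset.univ.filter fun j : Fin n => ∀ l, x (i l) j = a l).card : ℝ) / (n : ℝ)
                  - Phat a| ≤ ζ := by
  classical
  obtain ⟨Q, hQ⟩ := exists_nat_gt ((Fintype.card (Fin L → X) : ℝ) / ζ)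
  have hQ0 : (0 : ℝ) < Q := lt_of_le_of_lt (by positivity) hQ
  have hQp : 0 < Q := by exact_mod_cast hQ0
  obtain ⟨N, hN⟩ := ramsey_all L ((Fin L → X) → Fin (Q + 1)) M
  refine ⟨N + 1, by omega, fun n hn C hC => ?_⟩
  let e : Fin C.card ≃ C := C.equivFin.symm
  let c : Finset (Fin C.card) → ((Fin L → X) → Fin (Q + 1)) := fun s =>
    if h : s.card = L then qtype Q (fun l => (e (s.orderEmbOfFin h l) : Fin n → X))
    else fun _ => 0
  obtain ⟨T, -, hTc, k, hk⟩ := hN (Fin C.card) c Finset.univ (by simp; omega)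
  let x : Fin M → (Fin n → X) := fun m => (e (T.orderEmbOfFin hTc m) : Fin n → X)
  have key : ∀ i : Fin L → Fin M, StrictMono i → qtype Q (fun l => x (i l)) = k := by
    intro i hi
    let g : Fin L → Fin C.card := fun l => T.orderEmbOfFin hTc (i l)
    have hg : StrictMono g := (T.orderEmbOfFin hTc).strictMono.comp hi
    have hs : (Finset.univ.image g).card = L := by
      rw [Finset.card_image_of_injective _ hg.injective]; simp
    have h1 := hk (Finset.univ.image g) (by
      intro y hy
      obtain ⟨l, -, rfl⟩ := Finset.mem_image.mp hy
      exact Finset.orderEmbOfFin_mem _ _ _) hs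
    have h2 : g = (Finset.univ.image g).orderEmbOfFin hs :=
      Finset.orderEmbOfFin_unique hs (fun l => Finset.mem_image_of_mem _ (Finset.mem_univ _)) hg
    rw [← h1]
    simp only [c, dif_pos hs]
    rw [← h2]
  refine ⟨x, ?_, fun m => (e _).2, ?_⟩
  · intro p q hpq
    exact (T.orderEmbOfFin hTc).injective (e.injective (Subtype.ext hpq))
  by_cases hex : ∃ i : Fin L → Fin M, StrictMono i
  · obtain ⟨i₀, hi₀⟩ := hex
    refine ⟨jtype (fun l => x (i₀ l)), jtype_nonneg _, jtype_sum hn _, fun i hi => ?_⟩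
    calc _ ≤ ∑ a : Fin L → X, 1 / (Q : ℝ) := Finset.sum_le_sum fun a _ =>
            qtype_close hQp (fun l => x (i l)) _ ((key i hi).trans (key i₀ hi₀).symm) a
      _ ≤ ζ := by
        rw [Finset.sum_const, Finset.card_univ, nsmul_eq_mul, mul_one_div, div_le_iff₀ hQ0]
        rw [div_lt_iff₀ hζ] at hQ
        linarith
  · refine ⟨jtype (fun _ _ => Classical.arbitrary X : Fin L → Fin n → X), jtype_nonneg _,
      jtype_sum hn _, fun i hi => (hex ⟨i, hi⟩).elim⟩
end

section
/- Let L ≥ 2 be an integer, let r_L := 2^{−L} ∑_{x ∈ {−1,1}^L} |x_1 + ⋯ + x_L|, and let p be a real number with (1 − r_L/L)/2 < p ≤ 1/2. Then for every R > 0 there exists n₀ such that for all n ≥ n₀: every code C ⊆ (Fin n → ZMod 2) with the property that for every y ∈ (Fin n → ZMod 2), |{x ∈ C : hammingDist(x, y) ≤ p·n}| < L, satisfies |C| < 2^{R·n}. (Above the list-decoding Plotkin point (1 − r_L/L)/2, no positive rate is achievable for (p, L−1)-list decoding over the binary bit-flip channel.) -/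
open Finset

theorem ldp_prod_diff {κ : Type*} (s : Finset κ) (u v : κ → ℝ) (e : ℝ)
    (hu : ∀ i, 0 ≤ u i ∧ u i ≤ 1) (hv : ∀ i, 0 ≤ v i ∧ v i ≤ 1)
    (h : ∀ i, |u i - v i| ≤ e) : |∏ i ∈ s, u i - ∏ i ∈ s, v i| ≤ s.card * e := by
  classical
  induction s using Finset.induction_on with
  | empty => simp
  | insert a s ha ih =>
    rw [prod_insert ha, prod_insert ha, card_insert_of_notMem ha]
    have h1 : 0 ≤ ∏ i ∈ s, u i := prod_nonneg fun i _ => (hu i).1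
    have h2 : ∏ i ∈ s, u i ≤ 1 := prod_le_one (fun i _ => (hu i).1) fun i _ => (hu i).2
    set U := ∏ i ∈ s, u i
    set V := ∏ i ∈ s, v i
    have : u a * U - v a * V = (u a - v a) * U + v a * (U - V) := by ring
    rw [this]
    have h3 : |(u a - v a) * U| ≤ e := by
      rw [abs_mul, abs_of_nonneg h1]
      nlinarith [h a, abs_nonneg (u a - v a)]
    have h4 : |v a * (U - V)| ≤ s.card * e := by
      rw [abs_mul, abs_of_nonneg (hv a).1]
      nlinarith [abs_nonneg (U - V), hv a]
    push_cast
    linarith [abs_add_le ((u a - v a) * U) (v a * (U - V))]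

/-- the ±1 sum -/
noncomputable def ldpS {L : ℕ} (s : Fin L → Bool) : ℝ := ∑ i, (if s i = true then (1 : ℝ) else -1)

def ldpK {L : ℕ} (s : Fin L → Bool) : ℕ := (univ.filter fun i => s i = true).card

theorem ldpK_le {L : ℕ} (s : Fin L → Bool) : ldpK s ≤ L := by
  unfold ldpK
  exact (card_filter_le _ _).trans (by simp)

theorem ldpS_eq {L : ℕ} (s : Fin L → Bool) : ldpS s = 2 * (ldpK s : ℝ) - L := by
  unfold ldpS ldpK
  have : ∀ i, (if s i = true then (1 : ℝ) else -1) = 2 * (if s i = true then (1 : ℝ) else 0) - 1 := by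
    intro i; split_ifs <;> norm_num
  simp_rw [this]
  rw [sum_sub_distrib, ← mul_sum]
  simp

theorem ldp_prod_eq {L : ℕ} (s : Fin L → Bool) (a b : ℝ) :
    ∏ i, (if s i = true then a else b) = a ^ (ldpK s) * b ^ (L - ldpK s) := by
  rw [prod_ite]
  simp only [prod_const]
  congr 2
  have := card_filter_add_card_filter_not (s := (univ : Finset (Fin L))) (fun i => s i = true)
  simp only [card_univ, Fintype.card_fin] at this
  unfold ldpK
  omega

theorem ldp_pow_ineq (a b : ℝ) (ha : 0 ≤ a) (hb : 0 ≤ b) (L u u' : ℕ) (h : u' ≤ u) (hu : 2 * u ≤ L) :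
    a ^ u * b ^ (L - u) + b ^ u * a ^ (L - u) ≤ a ^ u' * b ^ (L - u') + b ^ u' * a ^ (L - u') := by
  obtain ⟨d, rfl⟩ := Nat.exists_eq_add_of_le h
  obtain ⟨m, rfl⟩ := Nat.exists_eq_add_of_le hu
  rw [show 2 * (u' + d) + m - (u' + d) = u' + (d + m) by omega,
    show 2 * (u' + d) + m - u' = u' + (d + m) + d by omega]
  have key : 0 ≤ (a ^ (d+m) - b ^ (d+m)) * (a ^ d - b ^ d) := by
    rcases le_total a b with hab | hab
    · exact mul_nonneg_of_nonpos_of_nonpos (sub_nonpos.2 (pow_le_pow_left₀ ha hab _))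
        (sub_nonpos.2 (pow_le_pow_left₀ ha hab _))
    · exact mul_nonneg (sub_nonneg.2 (pow_le_pow_left₀ hb hab _))
        (sub_nonneg.2 (pow_le_pow_left₀ hb hab _))
  have := mul_nonneg (mul_nonneg (pow_nonneg ha u') (pow_nonneg hb u')) key
  simp only [pow_add] at this ⊢
  nlinarith

theorem ldp_sum_prod (L : ℕ) (a b : ℝ) :
    ∑ s : Fin L → Bool, ∏ i, (if s i = true then a else b) = (a + b) ^ L := by
  have := Finset.prod_univ_sum (fun _ : Fin L => (univ : Finset Bool)) (fun _ t => if t = true then a else b)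
  rw [Fintype.piFinset_univ] at this
  rw [← this]
  simp

theorem ldp_bias (L : ℕ) (q : ℝ) (h0 : 0 ≤ q) (h1 : q ≤ 1) :
    (2 : ℝ) ^ (-(L : ℤ)) * ∑ s : Fin L → Bool, |ldpS s| ≤
      ∑ s : Fin L → Bool, (∏ i, (if s i = true then q else 1 - q)) * |ldpS s| := by
  classical
  set w : (Fin L → Bool) → ℝ := fun s =>
    (∏ i, (if s i = true then q else 1 - q)) + ∏ i, (if s i = true then 1 - q else q) with hw
  have hmono : Monovary w (fun s => |ldpS s|) := by
    intro s t hst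
    simp only [hw, ldp_prod_eq]
    simp only [ldpS_eq] at hst
    have hs := ldpK_le s
    have ht := ldpK_le t
    set k := ldpK s
    set l := ldpK t
    have e : ∀ k : ℕ, k ≤ L → ∃ u, 2 * u ≤ L ∧ |2 * (k:ℝ) - L| = L - 2 * u ∧
        q ^ k * (1 - q) ^ (L - k) + (1 - q) ^ k * q ^ (L - k) =
        q ^ u * (1 - q) ^ (L - u) + (1 - q) ^ u * q ^ (L - u) := by
      intro k hk
      rcases le_total (2 * k) L with h | h
      · refine ⟨k, h, ?_, rfl⟩
        have : (2 * k : ℝ) ≤ L := by exact_mod_cast h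
        rw [abs_of_nonpos (by linarith)]; ring
      · refine ⟨L - k, by omega, ?_, ?_⟩
        · have : (L : ℝ) ≤ 2 * k := by exact_mod_cast h
          rw [abs_of_nonneg (by linarith), Nat.cast_sub hk]; ring
        · rw [show L - (L - k) = k by omega]; ring
    obtain ⟨u, hu, hu1, hu2⟩ := e k hs
    obtain ⟨v, hv, hv1, hv2⟩ := e l ht
    rw [hu2, hv2]
    rw [hu1, hv1] at hst
    have : (v : ℝ) < u := by linarith
    exact ldp_pow_ineq q (1 - q) h0 (by linarith) L u v (by exact_mod_cast this.le) hu
  have hch := hmono.sum_mul_sum_le_card_mul_sum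
  have hsw : ∑ s, w s = 2 := by
    simp only [hw, sum_add_distrib, ldp_sum_prod]; norm_num
  have hflip : ∑ s : Fin L → Bool, (∏ i, (if s i = true then 1 - q else q)) * |ldpS s| =
      ∑ s : Fin L → Bool, (∏ i, (if s i = true then q else 1 - q)) * |ldpS s| := by
    refine Fintype.sum_equiv (Equiv.arrowCongr (Equiv.refl _) Equiv.boolNot) _ _ ?_
    intro s
    congr 1
    · apply prod_congr rfl; intro i _; cases h : s i <;> simp [h]
    · rw [← abs_neg]
      congr 1
      unfold ldpS
      rw [← sum_neg_distrib]
      apply sum_congr rfl; intro i _; cases h : s i <;> simp [h]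
  have hws : ∑ s, w s * |ldpS s| = 2 * ∑ s : Fin L → Bool, (∏ i, (if s i = true then q else 1 - q)) * |ldpS s| := by
    simp only [hw, add_mul, sum_add_distrib, hflip]; ring
  rw [hsw, hws] at hch
  simp only [Fintype.card_pi, Fintype.card_bool, prod_const, card_univ, Fintype.card_fin] at hch
  push_cast at hch
  rw [zpow_neg, zpow_natCast, inv_mul_le_iff₀ (by positivity)]
  linarith

/-- indicator -/
def ldpI (a b : Bool) : ℝ := if a = b then 1 else 0

noncomputable def ldpP {α ι : Type*} (x : α → ι → Bool) (D : Finset α) (j : ι) (a : Bool) : ℝ :=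
  (∑ c ∈ D, ldpI (x c j) a) / D.card

noncomputable def ldpJ {α ι : Type*} (x : α → ι → Bool) (D : Finset α) (j k : ι) (a b : Bool) : ℝ :=
  (∑ c ∈ D, ldpI (x c j) a * ldpI (x c k) b) / D.card

noncomputable def ldpCov {α ι : Type*} (x : α → ι → Bool) (D : Finset α) (j k : ι) : ℝ :=
  ldpJ x D j k true true - ldpP x D j true * ldpP x D k true

theorem ldpI_nonneg (a b : Bool) : 0 ≤ ldpI a b := by unfold ldpI; split_ifs <;> norm_num
theorem ldpI_le (a b : Bool) : ldpI a b ≤ 1 := by unfold ldpI; split_ifs <;> norm_num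
theorem ldpI_false (a : Bool) : ldpI a false = 1 - ldpI a true := by cases a <;> simp [ldpI]

section
variable {α ι : Type*} (x : α → ι → Bool) (D : Finset α)

theorem ldpP_mem (j : ι) (a : Bool) : 0 ≤ ldpP x D j a ∧ ldpP x D j a ≤ 1 := by
  unfold ldpP
  refine ⟨div_nonneg (sum_nonneg fun _ _ => ldpI_nonneg _ _) (by positivity), ?_⟩
  apply div_le_one_of_le₀ _ (by positivity)
  calc _ ≤ ∑ c ∈ D, (1:ℝ) := sum_le_sum fun _ _ => ldpI_le _ _
    _ = _ := by simp

theorem ldpJ_mem (j k : ι) (a b : Bool) : 0 ≤ ldpJ x D j k a b ∧ ldpJ x D j k a b ≤ 1 := by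
  unfold ldpJ
  refine ⟨div_nonneg (sum_nonneg fun _ _ => mul_nonneg (ldpI_nonneg _ _) (ldpI_nonneg _ _)) (by positivity), ?_⟩
  apply div_le_one_of_le₀ _ (by positivity)
  calc _ ≤ ∑ c ∈ D, (1:ℝ) := sum_le_sum fun _ _ =>
        mul_le_one₀ (ldpI_le _ _) (ldpI_nonneg _ _) (ldpI_le _ _)
    _ = _ := by simp

theorem ldpP_false (hD : D.Nonempty) (j : ι) : ldpP x D j false = 1 - ldpP x D j true := by
  have : (D.card : ℝ) ≠ 0 := by simpa using hD.ne_empty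
  unfold ldpP
  simp only [ldpI_false, sum_sub_distrib, sum_const, nsmul_eq_mul, mul_one]
  field_simp

theorem ldpJ_cov (hD : D.Nonempty) (j k : ι) (a b : Bool) :
    |ldpJ x D j k a b - ldpP x D j a * ldpP x D k b| = |ldpCov x D j k| := by
  have h0 : (D.card : ℝ) ≠ 0 := by simpa using hD.ne_empty
  have e1 : ∀ b, ldpJ x D j k false b = ldpP x D k b - ldpJ x D j k true b := by
    intro b
    unfold ldpJ ldpP
    simp only [ldpI_false (x _ j), sub_mul, one_mul, sum_sub_distrib, sub_div]
  have e2 : ∀ a, ldpJ x D j k a false = ldpP x D j a - ldpJ x D j k a true := by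
    intro b
    unfold ldpJ ldpP
    simp only [ldpI_false (x _ k), mul_sub, mul_one, sum_sub_distrib, sub_div]
  unfold ldpCov
  cases a <;> cases b
  · rw [e1, e2, ldpP_false x D hD, ldpP_false x D hD]; congr 1; ring
  · rw [e1, ldpP_false x D hD, ← abs_neg]; congr 1; ring
  · rw [e2, ldpP_false x D hD, ← abs_neg]; congr 1; ring
  · rfl

variable [Fintype ι]

noncomputable def ldpPhi : ℝ := ∑ k, ldpP x D k true ^ 2

theorem ldpPhi_nonneg : 0 ≤ ldpPhi x D := sum_nonneg fun _ _ => sq_nonneg _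

theorem ldpPhi_le : ldpPhi x D ≤ Fintype.card ι := by
  unfold ldpPhi
  calc _ ≤ ∑ k : ι, (1:ℝ) := sum_le_sum fun k _ => by
        have := ldpP_mem x D k true
        nlinarith
    _ = _ := by simp

theorem ldp_real (A1 A0 N1 N0 : ℝ) (h1 : 0 ≤ N1) (h0 : 0 ≤ N0) (hN : 0 < N1 + N0)
    (z1 : N1 = 0 → A1 = 0) (z0 : N0 = 0 → A0 = 0) :
    ((A1 + A0) / (N1 + N0)) ^ 2 + (A1 / (N1 + N0) - N1 / (N1 + N0) * ((A1 + A0) / (N1 + N0))) ^ 2 ≤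
    N1 / (N1 + N0) * (A1 / N1) ^ 2 + N0 / (N1 + N0) * (A0 / N0) ^ 2 := by
  rcases h1.eq_or_lt with h | h
  · have := z1 h.symm
    subst this
    rw [← h] at hN ⊢
    have : N0 ≠ 0 := by linarith
    simp only [zero_add, zero_div, zero_mul]
    field_simp; simp
  rcases h0.eq_or_lt with h' | h'
  · have := z0 h'.symm
    subst this
    rw [← h'] at hN ⊢
    simp only [add_zero, zero_div, zero_mul]
    field_simp; simp
  have e : N1 / (N1 + N0) * (A1 / N1) ^ 2 + N0 / (N1 + N0) * (A0 / N0) ^ 2 - (((A1 + A0) / (N1 + N0)) ^ 2 + (A1 / (N1 + N0) - N1 / (N1 + N0) * ((A1 + A0) / (N1 + N0))) ^ 2)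
    = (N0 * A1 - N1 * A0) ^ 2 * ((N1 + N0)^2 - N1 * N0) / (N1 * N0 * (N1 + N0) ^ 4) := by
    field_simp
    ring
  have : 0 ≤ (N0 * A1 - N1 * A0) ^ 2 * ((N1 + N0)^2 - N1 * N0) / (N1 * N0 * (N1 + N0) ^ 4) := by
    apply div_nonneg (mul_nonneg (sq_nonneg _) (by nlinarith)) (by positivity)
  linarith

theorem ldp_split (hD : D.Nonempty) (j : ι) :
    ldpPhi x D + ∑ k, ldpCov x D j k ^ 2 ≤
      ((D.filter fun c => x c j = true).card : ℝ) / D.card * ldpPhi x (D.filter fun c => x c j = true) +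
      ((D.filter fun c => ¬ x c j = true).card : ℝ) / D.card * ldpPhi x (D.filter fun c => ¬ x c j = true) := by
  unfold ldpPhi
  rw [mul_sum, mul_sum, ← sum_add_distrib, ← sum_add_distrib]
  apply sum_le_sum
  intro k _
  have hc : ((D.filter fun c => x c j = true).card : ℝ) + (D.filter fun c => ¬ x c j = true).card = D.card := by
    exact_mod_cast card_filter_add_card_filter_not (s := D) (fun c => x c j = true)
  have hs := sum_filter_add_sum_filter_not D (fun c => x c j = true) (fun c => ldpI (x c k) true)
  have hJ : ∑ c ∈ D, ldpI (x c j) true * ldpI (x c k) true =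
      ∑ c ∈ D.filter (fun c => x c j = true), ldpI (x c k) true := by
    rw [sum_filter]
    apply sum_congr rfl
    intro c _
    simp only [ldpI]; split_ifs <;> simp
  have hI : ∑ c ∈ D, ldpI (x c j) true = ((D.filter fun c => x c j = true).card : ℝ) := by
    simp [ldpI]
  have hpos : (0:ℝ) < D.card := by exact_mod_cast hD.card_pos
  unfold ldpCov ldpJ ldpP
  rw [hJ, hI, ← hs, ← hc]
  rw [← hc] at hpos
  apply ldp_real _ _ _ _ (by positivity) (by positivity) hpos
  · intro h
    have h : (D.filter fun c => x c j = true) = ∅ := by simpa only [Nat.cast_eq_zero, card_eq_zero] using h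
    rw [h]; simp
  · intro h
    have h : (D.filter fun c => ¬ x c j = true) = ∅ := by simpa only [Nat.cast_eq_zero, card_eq_zero] using h
    rw [h]; simp

theorem ldp_step (hD : D.Nonempty) (δ : ℝ) (hδ : 0 < δ) (hδ1 : δ ≤ 1) 
    (hn : 0 < Fintype.card ι)
    (h : δ * (Fintype.card ι : ℝ) ^ 2 ≤ ∑ j, ∑ k, ldpCov x D j k ^ 2) :
    ∃ E ⊆ D, E.Nonempty ∧ δ / 2 * D.card ≤ E.card ∧
      ldpPhi x D + δ / 2 * Fintype.card ι ≤ ldpPhi x E := by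
  have hn' : (0:ℝ) < Fintype.card ι := by exact_mod_cast hn
  obtain ⟨j, hj⟩ : ∃ j, δ * (Fintype.card ι : ℝ) ≤ ∑ k, ldpCov x D j k ^ 2 := by
    by_contra! hcon
    have : Nonempty ι := Fintype.card_pos_iff.1 hn
    have := sum_lt_sum_of_nonempty (s := (univ : Finset ι)) univ_nonempty (fun j _ => hcon j)
    simp at this
    nlinarith
  have hs := ldp_split x D hD j
  have hpos : (0:ℝ) < D.card := by exact_mod_cast hD.card_pos
  have hc : ((D.filter fun c => x c j = true).card : ℝ) + (D.filter fun c => ¬ x c j = true).card = D.card := by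
    exact_mod_cast card_filter_add_card_filter_not (s := D) (fun c => x c j = true)
  set E1 := D.filter fun c => x c j = true with hE1
  set E0 := D.filter fun c => ¬ x c j = true with hE0
  have p1 := ldpPhi_nonneg x E1
  have p0 := ldpPhi_nonneg x E0
  have q1 := ldpPhi_le x E1
  have q0 := ldpPhi_le x E0
  have hw : (E1.card : ℝ) / D.card + E0.card / D.card = 1 := by
    rw [← add_div, hc, div_self hpos.ne']
  have hw1 : 0 ≤ (E1.card : ℝ) / D.card := by positivity
  have hw0 : 0 ≤ (E0.card : ℝ) / D.card := by positivity
  have fin : ∀ E ⊆ D, δ / 2 ≤ (E.card : ℝ) / D.card →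
      ldpPhi x D + δ / 2 * Fintype.card ι ≤ ldpPhi x E →
      ∃ E ⊆ D, E.Nonempty ∧ δ / 2 * D.card ≤ E.card ∧
      ldpPhi x D + δ / 2 * Fintype.card ι ≤ ldpPhi x E := by
    intro E hE h1 h2
    rw [le_div_iff₀ hpos] at h1
    refine ⟨E, hE, ?_, h1, h2⟩
    have : (0:ℝ) < E.card := lt_of_lt_of_le (by positivity) h1
    exact card_pos.1 (by exact_mod_cast this)
  set w1 := (E1.card : ℝ) / D.card
  set w0 := (E0.card : ℝ) / D.card
  set n := (Fintype.card ι : ℝ)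
  by_cases c1 : w1 < δ / 2
  · apply fin E0 (filter_subset _ _) (by change δ / 2 ≤ w0; linarith)
    have : w1 * ldpPhi x E1 ≤ δ / 2 * n := by gcongr
    nlinarith
  by_cases c0 : w0 < δ / 2
  · apply fin E1 (filter_subset _ _) (by change δ / 2 ≤ w1; linarith)
    have : w0 * ldpPhi x E0 ≤ δ / 2 * n := by gcongr
    nlinarith
  push Not at c1 c0
  by_cases d1 : ldpPhi x D + δ / 2 * n ≤ ldpPhi x E1
  · exact fin E1 (filter_subset _ _) c1 d1
  · apply fin E0 (filter_subset _ _) c0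
    by_contra! d0
    push Not at d1
    have : w1 * ldpPhi x E1 + w0 * ldpPhi x E0 ≤ w1 * (ldpPhi x D + δ / 2 * n) + w0 * (ldpPhi x D + δ / 2 * n) := by
      gcongr
    rw [← add_mul, hw] at this
    nlinarith

theorem ldp_iter (δ : ℝ) (hδ : 0 < δ) (hδ1 : δ ≤ 1) (hn : 0 < Fintype.card ι) (t : ℕ) :
    ∀ D : Finset α, D.Nonempty → (Fintype.card ι : ℝ) - ldpPhi x D < t * (δ / 2 * Fintype.card ι) →
    ∃ E ⊆ D, E.Nonempty ∧ (δ / 2) ^ t * D.card ≤ E.card ∧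
      ∑ j, ∑ k, ldpCov x E j k ^ 2 < δ * (Fintype.card ι : ℝ) ^ 2 := by
  induction t with
  | zero =>
    intro D _ h
    have := ldpPhi_le x D
    simp at h
    linarith
  | succ t ih =>
    intro D hD h
    by_cases hc : δ * (Fintype.card ι : ℝ) ^ 2 ≤ ∑ j, ∑ k, ldpCov x D j k ^ 2
    · obtain ⟨E, hE, hEn, h1, h2⟩ := ldp_step x D hD δ hδ hδ1 hn hc
      obtain ⟨F, hF, hFn, h3, h4⟩ := ih E hEn (by push_cast at h; linarith)
      refine ⟨F, hF.trans hE, hFn, ?_, h4⟩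
      calc (δ / 2) ^ (t+1) * D.card = (δ/2)^t * (δ / 2 * D.card) := by ring
        _ ≤ (δ/2)^t * E.card := by gcongr
        _ ≤ _ := h3
    · refine ⟨D, Subset.rfl, hD, ?_, not_le.1 hc⟩
      have : (δ / 2) ^ (t+1) ≤ 1 := pow_le_one₀ (by positivity) (by linarith)
      nlinarith [(Nat.cast_nonneg D.card : (0:ℝ) ≤ D.card)]

end

section
variable {α ι : Type*} [Fintype ι] {L : ℕ} (x : α → ι → Bool) (D : Finset α)

def ldpZ (g : (Fin L → Bool) → ℝ) (c : Fin L → α) : ℝ := ∑ j, g (fun i => x (c i) j)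

noncomputable def ldpMu (g : (Fin L → Bool) → ℝ) : ℝ :=
  ∑ j, ∑ a : Fin L → Bool, g a * ∏ i, ldpP x D j (a i)

theorem ldp_pt (g : (Fin L → Bool) → ℝ) (s : Fin L → Bool) :
    g s = ∑ a : Fin L → Bool, g a * ∏ i, ldpI (s i) (a i) := by
  classical
  rw [sum_eq_single s]
  · simp [ldpI]
  · intro b _ hb
    obtain ⟨i, hi⟩ := Function.ne_iff.1 hb
    rw [prod_eq_zero (mem_univ i), mul_zero]
    simp [ldpI, hi.symm]
  · simp

theorem ldp_sum1 (hD : D.Nonempty) (g : (Fin L → Bool) → ℝ) :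
    ∑ c ∈ Fintype.piFinset (fun _ : Fin L => D), ldpZ x g c = (D.card : ℝ) ^ L * ldpMu x D g := by
  have h0 : (D.card : ℝ) ≠ 0 := by simpa using hD.ne_empty
  unfold ldpZ ldpMu
  rw [sum_comm, mul_sum]
  apply sum_congr rfl
  intro j _
  have : ∀ c : Fin L → α, g (fun i => x (c i) j) = ∑ a : Fin L → Bool, g a * ∏ i, ldpI (x (c i) j) (a i) :=
    fun c => ldp_pt g _
  simp_rw [this]
  rw [sum_comm, mul_sum]
  apply sum_congr rfl
  intro a _
  rw [← mul_sum, sum_prod_piFinset D (fun i d => ldpI (x d j) (a i))]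
  unfold ldpP
  rw [prod_div_distrib]
  simp only [prod_const, card_univ, Fintype.card_fin]
  field_simp

theorem ldp_sum2 (hD : D.Nonempty) (g : (Fin L → Bool) → ℝ) :
    ∑ c ∈ Fintype.piFinset (fun _ : Fin L => D), ldpZ x g c ^ 2 = (D.card : ℝ) ^ L *
      ∑ j, ∑ k, ∑ a : Fin L → Bool, ∑ b : Fin L → Bool, g a * g b * ∏ i, ldpJ x D j k (a i) (b i) := by
  have h0 : (D.card : ℝ) ≠ 0 := by simpa using hD.ne_empty
  unfold ldpZ
  simp_rw [sq, sum_mul_sum]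
  rw [sum_comm, mul_sum]
  apply sum_congr rfl
  intro j _
  rw [sum_comm, mul_sum]
  apply sum_congr rfl
  intro k _
  have : ∀ (c : Fin L → α) (j : ι), g (fun i => x (c i) j) = ∑ a : Fin L → Bool, g a * ∏ i, ldpI (x (c i) j) (a i) :=
    fun c j => ldp_pt g _
  simp_rw [this, sum_mul_sum]
  rw [sum_comm, mul_sum]
  apply sum_congr rfl
  intro a _
  rw [sum_comm, mul_sum]
  apply sum_congr rfl
  intro b _
  have : ∀ c : Fin L → α, g a * (∏ i, ldpI (x (c i) j) (a i)) * (g b * ∏ i, ldpI (x (c i) k) (b i)) =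
      g a * g b * ∏ i, (ldpI (x (c i) j) (a i) * ldpI (x (c i) k) (b i)) := by
    intro c; rw [prod_mul_distrib]; ring
  simp_rw [this]
  rw [← mul_sum, sum_prod_piFinset D (fun i d => ldpI (x d j) (a i) * ldpI (x d k) (b i))]
  unfold ldpJ
  rw [prod_div_distrib]
  simp only [prod_const, card_univ, Fintype.card_fin]
  field_simp

theorem ldp_var (hD : D.Nonempty) (g : (Fin L → Bool) → ℝ) (hg : ∀ a, 0 ≤ g a ∧ g a ≤ 1) :
    ∑ c ∈ Fintype.piFinset (fun _ : Fin L => D), (ldpZ x g c - ldpMu x D g) ^ 2 ≤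
      (D.card : ℝ) ^ L * (4 ^ L * L * ∑ j, ∑ k, |ldpCov x D j k|) := by
  have e : ∑ c ∈ Fintype.piFinset (fun _ : Fin L => D), (ldpZ x g c - ldpMu x D g) ^ 2 =
      (D.card : ℝ) ^ L * (∑ j, ∑ k, ∑ a : Fin L → Bool, ∑ b : Fin L → Bool, g a * g b *
        (∏ i, ldpJ x D j k (a i) (b i) - ∏ i, (ldpP x D j (a i) * ldpP x D k (b i)))) := by
    have : ∀ c, (ldpZ x g c - ldpMu x D g) ^ 2 =
        ldpZ x g c ^ 2 - 2 * ldpMu x D g * ldpZ x g c + ldpMu x D g ^ 2 := fun c => by ring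
    simp_rw [this]
    rw [sum_add_distrib, sum_sub_distrib, ← mul_sum, ldp_sum1 x D hD, ldp_sum2 x D hD]
    simp only [sum_const, Fintype.card_piFinset, prod_const, card_univ, Fintype.card_fin, nsmul_eq_mul]
    have hm : ldpMu x D g ^ 2 = ∑ j, ∑ k, ∑ a : Fin L → Bool, ∑ b : Fin L → Bool, g a * g b *
        ∏ i, (ldpP x D j (a i) * ldpP x D k (b i)) := by
      unfold ldpMu
      rw [sq, sum_mul_sum]
      refine sum_congr rfl fun j _ => sum_congr rfl fun k _ => ?_
      rw [sum_mul_sum]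
      refine sum_congr rfl fun a _ => sum_congr rfl fun b _ => ?_
      rw [prod_mul_distrib]; ring
    simp only [mul_sub, sum_sub_distrib]
    rw [← hm]
    push_cast
    ring
  rw [e]
  apply mul_le_mul_of_nonneg_left _ (by positivity)
  rw [mul_sum]
  apply sum_le_sum
  intro j _
  rw [mul_sum]
  apply sum_le_sum
  intro k _
  calc _ ≤ ∑ a : Fin L → Bool, ∑ b : Fin L → Bool, (L : ℝ) * |ldpCov x D j k| := by
        refine sum_le_sum fun a _ => sum_le_sum fun b _ => ?_
        have h1 := ldp_prod_diff univ (fun i : Fin L => ldpJ x D j k (a i) (b i))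
          (fun i => ldpP x D j (a i) * ldpP x D k (b i)) |ldpCov x D j k|
          (fun i => ldpJ_mem x D j k _ _)
          (fun i => ⟨mul_nonneg (ldpP_mem x D j _).1 (ldpP_mem x D k _).1,
            mul_le_one₀ (ldpP_mem x D j _).2 (ldpP_mem x D k _).1 (ldpP_mem x D k _).2⟩)
          (fun i => (ldpJ_cov x D hD j k _ _).le)
        simp only [card_univ, Fintype.card_fin] at h1
        refine le_trans (le_abs_self _) ?_
        rw [abs_mul, abs_of_nonneg (mul_nonneg (hg a).1 (hg b).1)]
        have : g a * g b ≤ 1 := mul_le_one₀ (hg a).2 (hg b).1 (hg b).2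
        exact (mul_le_of_le_one_left (abs_nonneg _) this).trans h1
    _ = _ := by
        simp only [sum_const, card_univ, Fintype.card_pi, Fintype.card_bool, prod_const, Fintype.card_fin, nsmul_eq_mul]
        push_cast
        rw [show (4:ℝ) = 2 * 2 by norm_num, mul_pow]; ring

theorem ldp_inj [DecidableEq α] (hN : 2 * L ^ 2 ≤ D.card) (hL : 1 ≤ L) :
    (D.card : ℝ) ^ L / 2 ≤
      (((Fintype.piFinset (fun _ : Fin L => D)).filter fun c => Function.Injective c).card : ℝ) := by
  have h1 : D.card.descFactorial L ≤ ((Fintype.piFinset (fun _ : Fin L => D)).filter fun c => Function.Injective c).card := by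
    have : Fintype.card (Fin L ↪ D) = D.card.descFactorial L := by
      rw [Fintype.card_embedding_eq]; simp
    rw [← this, ← card_univ]
    apply card_le_card_of_injOn (fun e i => (e i : α))
    · intro e _
      simp only [coe_filter, Set.mem_ofPred_eq, Fintype.mem_piFinset]
      exact ⟨fun i => (e i).2, fun i j h => e.injective (Subtype.ext h)⟩
    · intro e _ f _ h
      ext i
      exact congrFun h i
  have h2 := Nat.pow_sub_le_descFactorial D.card L
  have hLN : L ≤ D.card := by nlinarith
  have h3 : ((D.card : ℝ) - L) ^ L ≤ (((Fintype.piFinset (fun _ : Fin L => D)).filter fun c => Function.Injective c).card : ℝ) := by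
    rw [← Nat.cast_sub hLN]
    have : (D.card - L) ^ L ≤ (D.card + 1 - L) ^ L := Nat.pow_le_pow_left (by omega) _
    exact_mod_cast this.trans (h2.trans h1)
  refine le_trans ?_ h3
  have hp : (0:ℝ) < D.card := by exact_mod_cast (by omega : 0 < D.card)
  have hLN' : (L:ℝ) ≤ D.card := by exact_mod_cast hLN
  have hN' : 2 * (L:ℝ) ^ 2 ≤ D.card := by exact_mod_cast hN
  have hB := one_add_mul_le_pow (a := -((L:ℝ) / D.card)) (by
    have : (L:ℝ) / D.card ≤ 1 := div_le_one_of_le₀ hLN' hp.le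
    linarith) L
  have : (D.card : ℝ) - L = D.card * (1 + -((L:ℝ) / D.card)) := by field_simp; ring
  rw [this, mul_pow, div_eq_mul_inv]
  apply mul_le_mul_of_nonneg_left _ (by positivity)
  refine le_trans ?_ hB
  have : (L:ℝ) * (L / D.card) ≤ 1 / 2 := by
    rw [← mul_div_assoc, div_le_iff₀ hp]; nlinarith
  linarith

/-- majority -/
def ldpMaj (a : Fin L → Bool) : Bool := decide (L < 2 * ldpK a)

def ldpG (i : Fin L) (a : Fin L → Bool) : ℝ := if a i = ldpMaj a then 0 else 1

theorem ldpG_mem (i : Fin L) (a : Fin L → Bool) : 0 ≤ ldpG i a ∧ ldpG i a ≤ 1 := by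
  unfold ldpG; split_ifs <;> norm_num

theorem ldpK_comp (σ : Equiv.Perm (Fin L)) (a : Fin L → Bool) : ldpK (a ∘ σ) = ldpK a := by
  unfold ldpK
  rw [card_filter, card_filter]
  exact Fintype.sum_equiv σ _ _ (fun i => rfl)

theorem ldpMu_symm (i i' : Fin L) : ldpMu x D (ldpG i) = ldpMu x D (ldpG i') := by
  unfold ldpMu
  refine sum_congr rfl fun j _ => ?_
  refine Fintype.sum_equiv (Equiv.arrowCongr (Equiv.swap i i') (Equiv.refl _)) _ _ ?_
  intro a
  have h : (Equiv.arrowCongr (Equiv.swap i i') (Equiv.refl _)) a = a ∘ (Equiv.swap i i') := by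
    ext k; simp [Equiv.arrowCongr]
  rw [h]
  congr 1
  · simp [ldpG, ldpMaj, ldpK_comp]
    congr!
  · exact (Fintype.prod_equiv (Equiv.swap i i') _ _ (fun k => rfl)).symm

theorem ldpG_sum (a : Fin L → Bool) : ∑ i, ldpG i a = (L - |ldpS a|) / 2 := by
  rw [ldpS_eq]
  unfold ldpG ldpMaj
  have hc := card_filter_add_card_filter_not (s := (univ : Finset (Fin L))) (fun i => a i = true)
  simp only [card_univ, Fintype.card_fin] at hc
  by_cases h : L < 2 * ldpK a
  · have h' : (L:ℝ) < 2 * ldpK a := by exact_mod_cast h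
    rw [abs_of_nonneg (by linarith)]
    have : ∀ i, (if a i = decide (L < 2 * ldpK a) then (0:ℝ) else 1) = 1 - if a i = true then 1 else 0 := by
      intro i; simp [h]; split_ifs <;> simp
    simp_rw [this]
    rw [sum_sub_distrib]
    simp [ldpK]; ring
  · have h' : (2 * ldpK a : ℝ) ≤ L := by exact_mod_cast not_lt.1 h
    rw [abs_of_nonpos (by linarith)]
    have : ∀ i, (if a i = decide (L < 2 * ldpK a) then (0:ℝ) else 1) = if a i = true then 1 else 0 := by
      intro i; simp [h]; cases a i <;> simp
    simp_rw [this]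
    simp [ldpK]

theorem ldpMu_le (hD : D.Nonempty) (hL : 1 ≤ L) (i : Fin L) : ldpMu x D (ldpG i) ≤
    (1 - ((2 : ℝ) ^ (-(L : ℤ)) * ∑ s : Fin L → Bool, |ldpS s|) / (L : ℝ)) / 2 * Fintype.card ι := by
  have hL' : (0:ℝ) < L := by exact_mod_cast hL
  have h1 : (L:ℝ) * ldpMu x D (ldpG i) = ∑ i' : Fin L, ldpMu x D (ldpG i') := by
    rw [sum_congr rfl (fun i' _ => ldpMu_symm x D i' i)]; simp
  have h2 : ∑ i' : Fin L, ldpMu x D (ldpG i') =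
      ∑ j, ∑ a : Fin L → Bool, (∏ i, ldpP x D j (a i)) * ((L - |ldpS a|) / 2) := by
    unfold ldpMu
    rw [sum_comm]
    refine sum_congr rfl fun j _ => ?_
    rw [sum_comm]
    refine sum_congr rfl fun a _ => ?_
    rw [← sum_mul, ldpG_sum, mul_comm]
  set r := (2 : ℝ) ^ (-(L : ℤ)) * ∑ s : Fin L → Bool, |ldpS s| with hr
  have h3 : ∑ j, ∑ a : Fin L → Bool, (∏ i, ldpP x D j (a i)) * ((L - |ldpS a|) / 2) ≤
      ∑ j : ι, (L - r) / 2 := by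
    refine sum_le_sum fun j _ => ?_
    have hq := ldpP_mem x D j true
    have hb := ldp_bias L _ hq.1 hq.2
    rw [← hr] at hb
    have hPe : ∀ b, ldpP x D j b = if b = true then ldpP x D j true else 1 - ldpP x D j true := by
      intro b; cases b
      · simp [ldpP_false x D hD]
      · simp
    have hs := ldp_sum_prod L (ldpP x D j true) (1 - ldpP x D j true)
    have e : ∀ a : Fin L → Bool, (∏ i, ldpP x D j (a i)) =
      ∏ i, if a i = true then ldpP x D j true else 1 - ldpP x D j true :=
      fun a => prod_congr rfl fun i _ => hPe _
    simp_rw [e]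
    have : ∀ a : Fin L → Bool, (∏ i, if a i = true then ldpP x D j true else 1 - ldpP x D j true) * ((L - |ldpS a|) / 2)
      = L / 2 * (∏ i, if a i = true then ldpP x D j true else 1 - ldpP x D j true) -
       1 / 2 * ((∏ i, if a i = true then ldpP x D j true else 1 - ldpP x D j true) * |ldpS a|) := fun a => by ring
    simp_rw [this]
    rw [sum_sub_distrib, ← mul_sum, ← mul_sum, hs]
    simp only [add_sub_cancel, one_pow]
    linarith
  rw [← h2, ← h1] at h3
  simp only [sum_const, card_univ, nsmul_eq_mul] at h3
  rw [← mul_le_mul_iff_right₀ hL']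
  refine h3.trans (le_of_eq ?_)
  field_simp

end

theorem ldp_main (L : ℕ) (hL : 1 ≤ L) (p η s : ℝ) (hη : 0 < η) (hs : 0 < s)
    (hp : (1 - ((2 : ℝ) ^ (-(L : ℤ)) * ∑ s : Fin L → Bool, |ldpS s|) / (L : ℝ)) / 2 + η ≤ p)
    (hsη : (L:ℝ) * (4 ^ L * L * s) < η ^ 2 / 2)
    {α ι : Type*} [Fintype ι] [DecidableEq α] (hn : 0 < Fintype.card ι)
    (x : α → ι → Bool) (D : Finset α) (hN : 2 * L ^ 2 ≤ D.card)
    (hcov : ∑ j, ∑ k, ldpCov x D j k ^ 2 < s ^ 2 * (Fintype.card ι : ℝ) ^ 2) :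
    ∃ c : Fin L → α, Function.Injective c ∧ (∀ i, c i ∈ D) ∧
      ∀ i, ldpZ x (ldpG i) c ≤ p * Fintype.card ι := by
  have hn' : (0:ℝ) < Fintype.card ι := by exact_mod_cast hn
  have hNp : 0 < D.card := by have := Nat.pow_pos (n := 2) hL; omega
  have hD : D.Nonempty := card_pos.1 hNp
  have hNp' : (0:ℝ) < D.card := by exact_mod_cast hNp
  have habs : ∑ j, ∑ k, |ldpCov x D j k| ≤ s * (Fintype.card ι : ℝ) ^ 2 := by
    have h := sq_sum_le_card_mul_sum_sq (s := (univ : Finset (ι × ι))) (f := fun z => |ldpCov x D z.1 z.2|)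
    simp only [Fintype.sum_prod_type, sq_abs, card_univ, Fintype.card_prod] at h
    push_cast at h
    refine (sq_le_sq₀ (sum_nonneg fun _ _ => sum_nonneg fun _ _ => abs_nonneg _) (by positivity)).1 ?_
    nlinarith
  by_contra! hcon
  set Ω := Fintype.piFinset (fun _ : Fin L => D)
  have hlow : (D.card : ℝ) ^ L / 2 * (η * Fintype.card ι) ^ 2 ≤
      ∑ c ∈ Ω, ∑ i, (ldpZ x (ldpG i) c - ldpMu x D (ldpG i)) ^ 2 := by
    calc _ ≤ ((Ω.filter fun c => Function.Injective c).card : ℝ) * (η * Fintype.card ι) ^ 2 := by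
          gcongr; exact ldp_inj D hN hL
      _ = ∑ c ∈ Ω.filter (fun c => Function.Injective c), (η * Fintype.card ι) ^ 2 := by simp
      _ ≤ ∑ c ∈ Ω.filter (fun c => Function.Injective c), ∑ i, (ldpZ x (ldpG i) c - ldpMu x D (ldpG i)) ^ 2 := by
          apply sum_le_sum
          intro c hc
          rw [mem_filter, Fintype.mem_piFinset] at hc
          obtain ⟨i, hi⟩ := hcon c hc.2 hc.1
          refine le_trans ?_ (single_le_sum (fun i _ => sq_nonneg _) (mem_univ i))
          have := ldpMu_le x D hD hL i
          apply pow_le_pow_left₀ (by positivity)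
          nlinarith
      _ ≤ _ := sum_le_sum_of_subset_of_nonneg (filter_subset _ _)
          (fun c _ _ => sum_nonneg fun i _ => sq_nonneg _)
  rw [sum_comm] at hlow
  have hup : ∑ i : Fin L, ∑ c ∈ Ω, (ldpZ x (ldpG i) c - ldpMu x D (ldpG i)) ^ 2 ≤
      ∑ i : Fin L, (D.card : ℝ) ^ L * (4 ^ L * L * (s * (Fintype.card ι : ℝ) ^ 2)) := by
    refine sum_le_sum fun i _ => (ldp_var x D hD _ (ldpG_mem i)).trans ?_
    gcongr
  simp only [sum_const, card_univ, Fintype.card_fin, nsmul_eq_mul] at hup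
  have h := hlow.trans hup
  have hX : 0 < (D.card : ℝ) ^ L * (Fintype.card ι : ℝ) ^ 2 := by positivity
  have := mul_lt_mul_of_pos_left hsη hX
  nlinarith

theorem ldp_const (L : ℕ) (hL : 1 ≤ L) (p : ℝ)
    (hp : (1 - ((2 : ℝ) ^ (-(L : ℤ)) * ∑ s : Fin L → Bool, |ldpS s|) / (L : ℝ)) / 2 < p) :
    ∃ M : ℝ, ∀ n : ℕ, 1 ≤ n → ∀ C : Finset (Fin n → ZMod 2),
      (∀ y : Fin n → ZMod 2,
          ∀ T ⊆ C, (∀ z ∈ T, (hammingDist z y : ℝ) ≤ p * (n : ℝ)) → T.card < L) →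
        (C.card : ℝ) < M := by
  classical
  obtain ⟨η, hη, hpη⟩ : ∃ η : ℝ, 0 < η ∧
    (1 - ((2 : ℝ) ^ (-(L : ℤ)) * ∑ s : Fin L → Bool, |ldpS s|) / (L : ℝ)) / 2 + η ≤ p :=
    ⟨_, sub_pos.2 hp, by linarith⟩
  have hL' : (0:ℝ) < L := by exact_mod_cast hL
  obtain ⟨s, hs, hs1, hsη⟩ : ∃ s : ℝ, 0 < s ∧ s ≤ 1 ∧ (L:ℝ) * (4 ^ L * L * s) < η ^ 2 / 2 := by
    have hB : 0 < (L:ℝ) * (4 ^ L * L) := by positivity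
    refine ⟨min 1 (η ^ 2 / 4 / ((L:ℝ) * (4 ^ L * L))), lt_min one_pos (by positivity), min_le_left _ _, ?_⟩
    have h := min_le_right 1 (η ^ 2 / 4 / ((L:ℝ) * (4 ^ L * L)))
    rw [le_div_iff₀ hB] at h
    have : 0 < η ^ 2 := by positivity
    nlinarith
  have hδ : 0 < s ^ 2 := by positivity
  have hδ1 : s ^ 2 ≤ 1 := pow_le_one₀ hs.le hs1
  obtain ⟨t, ht⟩ := exists_nat_gt (1 / (s ^ 2 / 2))
  rw [div_lt_iff₀ (by positivity)] at ht
  refine ⟨2 * L ^ 2 / (s ^ 2 / 2) ^ t, fun n hn C hC => ?_⟩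
  by_contra! hcard
  rw [div_le_iff₀ (by positivity)] at hcard
  have hn' : (0:ℝ) < n := by exact_mod_cast hn
  have hCn : C.Nonempty := by
    rw [nonempty_iff_ne_empty]; rintro rfl
    simp at hcard
    nlinarith
  let x : (Fin n → ZMod 2) → Fin n → Bool := fun c j => decide (c j = 1)
  obtain ⟨D, hDC, hDn, hDcard, hcov⟩ := ldp_iter x (s ^ 2) hδ hδ1 (by simpa using Nat.pos_of_ne_zero (by omega)) t C hCn (by
    have := ldpPhi_nonneg x C
    simp only [Fintype.card_fin]
    nlinarith)
  obtain ⟨c, hc, hcD, hcZ⟩ := ldp_main L hL p η s hη hs hpη hsη (by simpa using Nat.pos_of_ne_zero (by omega)) x D (by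
    have : (2 * L ^ 2 : ℝ) ≤ D.card := by linarith
    exact_mod_cast this) hcov
  have h01 : ∀ z : ZMod 2, z = 0 ∨ z = 1 := by decide
  have := hC (fun j => if ldpMaj (fun i => x (c i) j) = true then 1 else 0) (univ.image c)
    (by intro z hz; simp at hz; obtain ⟨i, rfl⟩ := hz; exact hDC (hcD i))
    (by
      intro z hz; simp at hz; obtain ⟨i, rfl⟩ := hz
      refine le_trans (le_of_eq ?_) ((hcZ i).trans (by simp))
      unfold hammingDist ldpZ ldpG
      rw [card_filter]
      push_cast
      refine sum_congr rfl fun j _ => ?_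
      have hx : x (c i) j = decide (c i j = 1) := rfl
      rcases h01 (c i j) with h | h <;>
        cases hm : ldpMaj (fun i => x (c i) j) <;> simp [h, hm, hx])
  rw [card_image_of_injective _ hc] at this
  simp at this


open Finset
open Classical in
/-- **Above the list-decoding Plotkin point, no positive rate.** Let `L ≥ 2`,
`r_L := 2^{−L} ∑_{x ∈ {−1,1}^L} |x_1 + ⋯ + x_L|`, and `(1 − r_L/L)/2 < p ≤ 1/2`.
Then for every rate `R > 0`, all sufficiently long `(p, L−1)`-list decodable binary
codes have fewer than `2^{Rn}` codewords. -/
theorem list_decoding_plotkin_converse (L : ℕ) (hL : 2 ≤ L) (p : ℝ)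
    (hp_lb : (1 - ((2 : ℝ) ^ (-(L : ℤ)) *
          ∑ s : Fin L → Bool, |∑ i, (if s i = true then (1 : ℝ) else -1)|) / (L : ℝ)) / 2 < p)
    (hp_ub : p ≤ 1 / 2) :
    ∀ R : ℝ, 0 < R → ∃ n₀ : ℕ, ∀ n : ℕ, n₀ ≤ n →
      ∀ C : Finset (Fin n → ZMod 2),
        (∀ y : Fin n → ZMod 2,
          (C.filter fun x => (hammingDist x y : ℝ) ≤ p * (n : ℝ)).card < L) →
        (C.card : ℝ) < 2 ^ (R * (n : ℝ)) := by
  intro R hR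
  obtain ⟨M, hM⟩ := ldp_const L (by omega) p hp_lb
  obtain ⟨n₀, hn₀⟩ := exists_nat_gt (Real.logb 2 (max M 1) / R)
  refine ⟨n₀ + 1, fun n hn C hC => ?_⟩
  have h1 : (C.card : ℝ) < M := by
    refine hM n (by omega) C fun y T hT h => lt_of_le_of_lt (card_le_card ?_) (hC y)
    intro z hz
    rw [mem_filter]
    exact ⟨hT hz, h z hz⟩
  have hmax : 0 < max M 1 := lt_max_of_lt_right one_pos
  have hn' : (n₀ : ℝ) ≤ n := by exact_mod_cast (by omega : n₀ ≤ n)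
  rw [div_lt_iff₀ hR] at hn₀
  have h2 : Real.logb 2 (max M 1) ≤ R * n := by nlinarith
  rw [Real.logb_le_iff_le_rpow one_lt_two hmax] at h2
  exact lt_of_lt_of_le h1 ((le_max_left _ _).trans h2)
end

section
/- Let L ≥ 2 be an integer, let r_L := 2^{−L} ∑_{x ∈ {−1,1}^L} |x_1 + ⋯ + x_L|, and let p be a real number with 0 ≤ p < (1 − r_L/L)/2. Then there exist R > 0 and n₀ such that for all n ≥ n₀ there exists a code C ⊆ (Fin n → ZMod 2) with |C| ≥ 2^{R·n} such that for every y ∈ (Fin n → ZMod 2), |{x ∈ C : hammingDist(x, y) ≤ p·n}| < L. (Below the list-decoding Plotkin point (1 − r_L/L)/2, positive-rate (p, L−1)-list decodable codes exist for the binary bit-flip channel.) -/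
open Finset

/-- Absolute value of the walk associated with a binary column. -/
noncomputable def walkAbs {L : ℕ} (c : Fin L → ZMod 2) : ℝ :=
  |∑ i, (if c i = 1 then (1 : ℝ) else -1)|

lemma walkAbs_sum (L : ℕ) :
    ∑ c : Fin L → ZMod 2, walkAbs c =
      ∑ s : Fin L → Bool, |∑ i, (if s i = true then (1 : ℝ) else -1)| := by
  refine Fintype.sum_equiv (Equiv.arrowCongr (Equiv.refl (Fin L)) (finTwoEquiv : ZMod 2 ≃ Bool)) _ _ ?_
  intro c
  unfold walkAbs
  congr 1
  refine Finset.sum_congr rfl fun i _ => ?_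
  have key : ∀ a : ZMod 2, (a = 1 ↔ (finTwoEquiv : ZMod 2 ≃ Bool) a = true) := by
    intro a
    change Fin 2 at a
    change a = (1 : Fin 2) ↔ finTwoEquiv a = true
    revert a
    decide
  simp only [Equiv.arrowCongr_apply, Equiv.refl_symm, Equiv.coe_refl, Function.comp, id, key (c i)]

lemma column_bound {L : ℕ} (c : Fin L → ZMod 2) (b : ZMod 2) :
    (L : ℝ) - 2 * ∑ i, (if c i ≠ b then (1 : ℝ) else 0) ≤ walkAbs c := by
  have h1 : (L : ℝ) - 2 * ∑ i, (if c i ≠ b then (1 : ℝ) else 0)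
      = ∑ i, (1 - 2 * (if c i ≠ b then (1 : ℝ) else 0)) := by
    rw [Finset.sum_sub_distrib, ← Finset.mul_sum]; simp
  rw [h1]
  have hb2 : ∀ b : ZMod 2, b = 1 ∨ b = 0 := by decide
  have hb := hb2 b
  unfold walkAbs
  rcases hb with rfl | rfl
  · refine le_trans (le_of_eq ?_) (le_abs_self _)
    refine Finset.sum_congr rfl fun i _ => ?_
    by_cases h : c i = 1 <;> simp [h]; norm_num
  · refine le_trans (le_of_eq ?_) (neg_le_abs _)
    rw [← Finset.sum_neg_distrib]
    refine Finset.sum_congr rfl fun i _ => ?_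
    have h2 : ∀ a : ZMod 2, a = 0 ∨ a = 1 := by decide
    rcases h2 (c i) with h | h <;> simp [h]; norm_num

/-- A tuple contained in a Hamming ball. -/
def BadTuple {L : ℕ} (n : ℕ) (p : ℝ) (z : Fin L → Fin n → ZMod 2) : Prop :=
  ∃ y : Fin n → ZMod 2, ∀ i, (hammingDist (z i) y : ℝ) ≤ p * (n : ℝ)

lemma bad_sum {L n : ℕ} {p : ℝ} {z : Fin L → Fin n → ZMod 2} (h : BadTuple n p z) :
    0 ≤ ∑ j, (walkAbs (fun i => z i j) - (L : ℝ) * (1 - 2 * p)) := by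
  obtain ⟨y, hy⟩ := h
  have h1 : ∑ j, ((L : ℝ) - 2 * ∑ i, (if z i j ≠ y j then (1 : ℝ) else 0))
      ≤ ∑ j, walkAbs (fun i => z i j) :=
    Finset.sum_le_sum fun j _ => column_bound (fun i => z i j) (y j)
  have h2 : ∑ j, ∑ i, (if z i j ≠ y j then (1 : ℝ) else 0) ≤ (L : ℝ) * (p * n) := by
    rw [Finset.sum_comm]
    calc ∑ i, ∑ j, (if z i j ≠ y j then (1 : ℝ) else 0)
        = ∑ i, (hammingDist (z i) y : ℝ) := by
          refine Finset.sum_congr rfl fun i _ => ?_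
          rw [hammingDist, Finset.sum_boole]
      _ ≤ ∑ _i : Fin L, p * (n : ℝ) := Finset.sum_le_sum fun i _ => hy i
      _ = _ := by simp
  rw [Finset.sum_sub_distrib, ← Finset.mul_sum] at h1
  rw [Finset.sum_sub_distrib]
  simp only [Finset.sum_const, Finset.card_univ, Fintype.card_fin, nsmul_eq_mul] at h1 ⊢
  nlinarith

open Classical in
lemma card_bad {L n : ℕ} {p t : ℝ} (ht : 0 ≤ t) :
    ((Finset.univ.filter fun z : Fin L → Fin n → ZMod 2 => BadTuple n p z).card : ℝ)
      ≤ (∑ c : Fin L → ZMod 2, Real.exp (t * (walkAbs c - (L : ℝ) * (1 - 2 * p)))) ^ n := by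
  rw [Fintype.sum_pow, Finset.card_filter]
  push_cast
  have : ∑ w : Fin n → Fin L → ZMod 2,
        ∏ j, Real.exp (t * (walkAbs (w j) - (L : ℝ) * (1 - 2 * p)))
      = ∑ z : Fin L → Fin n → ZMod 2,
        ∏ j, Real.exp (t * (walkAbs (fun i => z i j) - (L : ℝ) * (1 - 2 * p))) :=
    Fintype.sum_equiv (Equiv.piComm _) _ _ (fun w => rfl)
  rw [this]
  refine Finset.sum_le_sum fun z _ => ?_
  rw [← Real.exp_sum, ← Finset.mul_sum]
  split_ifs with h
  · exact Real.one_le_exp (mul_nonneg ht (bad_sum h))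
  · positivity

open Classical in
lemma card_fiber {V : Type} [Fintype V] {L M : ℕ} (P : (Fin L → V) → Prop) (f : Fin L ↪ Fin M) :
    (Finset.univ.filter fun x : Fin M → V => P (x ∘ f)).card
      ≤ (Finset.univ.filter P).card * Fintype.card V ^ (M - L) := by
  have hc : Fintype.card ({a : Fin M // a ∉ Set.range f} → V) = Fintype.card V ^ (M - L) := by
    rw [Fintype.card_fun, Fintype.card_subtype_compl]
    congr 2
    · simp
    · rw [← Nat.card_eq_fintype_card]
      have := Nat.card_range_of_injective f.injective
      rw [Nat.card_fin] at this
      exact this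
  rw [← hc, ← Finset.card_univ, ← Finset.card_product]
  refine Finset.card_le_card_of_injOn
    (fun x => (x ∘ f, fun a : {a : Fin M // a ∉ Set.range f} => x a)) ?_ ?_
  · intro x hx
    simpa using hx
  · intro x _ x' _ h
    simp only [Prod.mk.injEq] at h
    funext a
    by_cases ha : a ∈ Set.range f
    · obtain ⟨i, rfl⟩ := ha
      exact congrFun h.1 i
    · exact congrFun h.2 ⟨a, ha⟩

open Classical in
lemma exists_good {V : Type} [Fintype V] [Nonempty V] {L M : ℕ} (P : (Fin L → V) → Prop)
    (h : M ^ L * (Finset.univ.filter P).card < Fintype.card V ^ L) :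
    ∃ x : Fin M → V, ∀ f : Fin L ↪ Fin M, ¬ P (x ∘ f) := by
  by_contra hcon
  push Not at hcon
  obtain ⟨f₀, _⟩ := hcon (fun _ => Classical.arbitrary V)
  have hLM : L ≤ M := by simpa using Fintype.card_le_of_embedding f₀
  have hcov : (Finset.univ : Finset (Fin M → V)) ⊆
      (Finset.univ : Finset (Fin L ↪ Fin M)).biUnion
        (fun f => Finset.univ.filter fun x : Fin M → V => P (x ∘ f)) := by
    intro x _
    obtain ⟨f, hf⟩ := hcon x
    simp only [Finset.mem_biUnion, Finset.mem_filter, Finset.mem_univ, true_and]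
    exact ⟨f, hf⟩
  have h1 := (Finset.card_le_card hcov).trans Finset.card_biUnion_le
  have h2 := h1.trans (Finset.sum_le_sum fun f _ => card_fiber P f)
  rw [Finset.sum_const, Finset.card_univ, Finset.card_univ, smul_eq_mul, Fintype.card_fun,
    Fintype.card_fin] at h2
  have h3 : Fintype.card (Fin L ↪ Fin M) ≤ M ^ L := by
    have := Fintype.card_le_of_injective (fun f : Fin L ↪ Fin M => (f : Fin L → Fin M))
      DFunLike.coe_injective
    simpa using this
  have h4 : Fintype.card V ^ M ≤ M ^ L * ((Finset.univ.filter P).card * Fintype.card V ^ (M - L)) :=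
    h2.trans (Nat.mul_le_mul_right _ h3)
  have hpos : 0 < Fintype.card V ^ (M - L) := pow_pos Fintype.card_pos _
  have h5 : Fintype.card V ^ M = Fintype.card V ^ L * Fintype.card V ^ (M - L) := by
    rw [← pow_add]; congr 1; omega
  have := Nat.mul_lt_mul_of_pos_right h hpos
  rw [h5, ← mul_assoc] at h4
  omega

lemma exists_tilt {α : Type} [Fintype α] (u : α → ℝ) (hu : ∑ c, u c < 0) :
    ∃ t : ℝ, 0 < t ∧ ∑ c, Real.exp (t * u c) < Fintype.card α := by
  have hd : HasDerivAt (fun t : ℝ => ∑ c, Real.exp (t * u c)) (∑ c, u c) 0 := by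
    have : ∀ c ∈ (Finset.univ : Finset α), HasDerivAt (fun t : ℝ => Real.exp (t * u c)) (u c) 0 := by
      intro c _
      have := ((hasDerivAt_id (0 : ℝ)).mul_const (u c)).exp
      simpa using this
    exact HasDerivAt.fun_sum this
  have hs := hasDerivAt_iff_tendsto_slope.1 hd
  have hev := (hs.mono_left (nhdsWithin_mono (0 : ℝ)
    (fun x (hx : x ∈ Set.Ioi (0 : ℝ)) => ne_of_gt hx))).eventually (gt_mem_nhds hu)
  obtain ⟨t, ht, ht0⟩ := (hev.and self_mem_nhdsWithin).exists
  have ht0 : 0 < t := ht0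
  refine ⟨t, ht0, ?_⟩
  rw [slope_def_field, div_neg_iff] at ht
  rcases ht with ht | ht
  · linarith [ht.2]
  · have := ht.1
    simp at this
    simpa using this

open Classical in
/-- **Below the list-decoding Plotkin point, positive rate is achievable.** Let
`L ≥ 2`, `r_L := 2^{−L} ∑_{x ∈ {−1,1}^L} |x_1 + ⋯ + x_L|`, and
`0 ≤ p < (1 − r_L/L)/2`. Then there is a rate `R > 0` such that for all
sufficiently large `n` there exists a binary code of size at least `2^{Rn}` in
which every Hamming ball of radius `p·n` contains fewer than `L` codewords. -/
theorem list_decoding_plotkin_achievability (L : ℕ) (hL : 2 ≤ L) (p : ℝ) (hp0 : 0 ≤ p)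
    (hp : p < (1 - ((2 : ℝ) ^ (-(L : ℤ)) *
          ∑ s : Fin L → Bool, |∑ i, (if s i = true then (1 : ℝ) else -1)|) / (L : ℝ)) / 2) :
    ∃ R : ℝ, 0 < R ∧ ∃ n₀ : ℕ, ∀ n : ℕ, n₀ ≤ n →
      ∃ C : Finset (Fin n → ZMod 2),
        (2 : ℝ) ^ (R * (n : ℝ)) ≤ (C.card : ℝ) ∧
        ∀ y : Fin n → ZMod 2,
          (C.filter fun x => (hammingDist x y : ℝ) ≤ p * (n : ℝ)).card < L := by
  set r : ℝ := ∑ s : Fin L → Bool, |∑ i, (if s i = true then (1 : ℝ) else -1)| with hr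
  have hL0 : (0 : ℝ) < L := by positivity
  have hu : ∑ c : Fin L → ZMod 2, (walkAbs c - (L : ℝ) * (1 - 2 * p)) < 0 := by
    rw [Finset.sum_sub_distrib, walkAbs_sum, ← hr]
    simp only [Finset.sum_const, Finset.card_univ, Fintype.card_fun, Fintype.card_fin, ZMod.card,
      nsmul_eq_mul, Nat.cast_pow, Nat.cast_ofNat]
    have h1 : ((2 : ℝ) ^ (-(L : ℤ)) * r) / L < 1 - 2 * p := by linarith
    rw [div_lt_iff₀ hL0, zpow_neg, zpow_natCast, inv_mul_lt_iff₀ (by positivity)] at h1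
    linarith
  obtain ⟨t, ht, hphi⟩ := exists_tilt _ hu
  set φ : ℝ := ∑ c : Fin L → ZMod 2, Real.exp (t * (walkAbs c - (L : ℝ) * (1 - 2 * p))) with hφ
  have hφ0 : 0 ≤ φ := Finset.sum_nonneg fun c _ => (Real.exp_pos _).le
  have hcard : ((Fintype.card (Fin L → ZMod 2) : ℕ) : ℝ) = 2 ^ L := by simp
  rw [hcard] at hphi
  obtain ⟨R, hR, hR0⟩ : ∃ R : ℝ, ((2 : ℝ) ^ R) ^ L * φ < 2 ^ L ∧ 0 < R := by
    have hc : ContinuousAt (fun R : ℝ => ((2 : ℝ) ^ R) ^ L * φ) 0 := by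
      have : Continuous (fun R : ℝ => (2 : ℝ) ^ R) := Real.continuous_const_rpow (by norm_num)
      fun_prop
    have hev := hc.eventually_lt_const (u := (2 : ℝ) ^ L) (by simpa using hphi)
    exact ((hev.filter_mono nhdsWithin_le_nhds).and
      (self_mem_nhdsWithin (s := Set.Ioi (0 : ℝ)))).exists
  refine ⟨R, hR0, ?_⟩
  set q : ℝ := ((2 : ℝ) ^ R) ^ L * φ / 2 ^ L with hq
  have hq0 : 0 ≤ q := by positivity
  have hq1 : q < 1 := by rw [hq, div_lt_one (by positivity)]; exact hR
  have hlim : Filter.Tendsto (fun n : ℕ => ((L : ℝ) + 1) ^ L * q ^ n) Filter.atTop (nhds 0) := by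
    simpa using (tendsto_pow_atTop_nhds_zero_of_lt_one hq0 hq1).const_mul (((L : ℝ) + 1) ^ L)
  obtain ⟨n₀, hn₀⟩ := Filter.eventually_atTop.1 (hlim.eventually (gt_mem_nhds one_pos))
  refine ⟨n₀, fun n hn => ?_⟩
  have hlt := hn₀ n hn
  set A : ℝ := (2 : ℝ) ^ (R * (n : ℝ)) with hA
  have hA1 : 1 ≤ A := Real.one_le_rpow (by norm_num) (by positivity)
  have hAn : A = ((2 : ℝ) ^ R) ^ n := by rw [hA, Real.rpow_mul (by norm_num), Real.rpow_natCast]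
  set M : ℕ := ⌈(L : ℝ) * A⌉₊ with hM
  have hMlo : (L : ℝ) * A ≤ M := Nat.le_ceil _
  have hMhi : (M : ℝ) ≤ (L + 1) * A := by
    have := Nat.ceil_lt_add_one (a := (L : ℝ) * A) (by positivity)
    rw [← hM] at this
    nlinarith
  have hB := card_bad (L := L) (n := n) (p := p) ht.le
  rw [← hφ] at hB
  have hcount : M ^ L * (Finset.univ.filter
      (fun z : Fin L → Fin n → ZMod 2 => BadTuple n p z)).card
      < Fintype.card (Fin n → ZMod 2) ^ L := by
    have : ((M : ℝ) ^ L * ((Finset.univ.filter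
      (fun z : Fin L → Fin n → ZMod 2 => BadTuple n p z)).card : ℝ)) < ((2 : ℝ) ^ n) ^ L := by
      calc _ ≤ ((L + 1) * A) ^ L * φ ^ n := by gcongr
        _ = (((L : ℝ) + 1) ^ L * q ^ n) * ((2 : ℝ) ^ n) ^ L := by
          rw [hq, hAn, div_pow, mul_pow, mul_pow, ← pow_mul, ← pow_mul, ← pow_mul, ← pow_mul,
            mul_comm n L]
          field_simp
        _ < 1 * ((2 : ℝ) ^ n) ^ L := by gcongr
        _ = _ := one_mul _
    have hV : Fintype.card (Fin n → ZMod 2) = 2 ^ n := by simp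
    rw [hV]
    exact_mod_cast this
  obtain ⟨x, hx⟩ := exists_good _ hcount
  refine ⟨Finset.univ.image x, ?_, ?_⟩
  · have hfib : (Finset.univ : Finset (Fin M)).card ≤ L * (Finset.univ.image x).card := by
      refine Finset.card_le_mul_card_image _ _ fun v _ => ?_
      by_contra hcon
      push Not at hcon
      obtain ⟨f⟩ : Nonempty (Fin L ↪ (Finset.univ.filter fun a => x a = v : Finset (Fin M))) := by
        apply Function.Embedding.nonempty_of_card_le
        rw [Fintype.card_fin, Fintype.card_coe]
        exact hcon.le
      refine hx (f.trans (Function.Embedding.subtype _)) ⟨v, fun i => ?_⟩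
      have := (Finset.mem_filter.1 (f i).2).2
      simp only [Function.comp, Function.Embedding.trans_apply, Function.Embedding.subtype_apply,
        this, hammingDist_self]
      simp only [Nat.cast_zero]
      positivity
    rw [Finset.card_univ, Fintype.card_fin] at hfib
    have hfib' : (M : ℝ) ≤ L * ((Finset.univ.image x).card : ℝ) := by exact_mod_cast hfib
    exact le_of_mul_le_mul_left (hMlo.trans hfib') hL0
  · intro y
    by_contra hcon
    push Not at hcon
    obtain ⟨f⟩ : Nonempty (Fin L ↪ ((Finset.univ.image x).filter
        fun v => (hammingDist v y : ℝ) ≤ p * (n : ℝ) : Finset (Fin n → ZMod 2))) := by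
      apply Function.Embedding.nonempty_of_card_le
      rw [Fintype.card_fin, Fintype.card_coe]
      exact hcon
    have hf : ∀ i, ∃ a, x a = (f i : Fin n → ZMod 2) := fun i => by
      have := (Finset.mem_filter.1 (f i).2).1
      simpa using this
    choose g hg using hf
    have hginj : Function.Injective g := fun i j hij => by
      apply f.injective
      apply Subtype.ext
      rw [← hg i, ← hg j, hij]
    refine hx ⟨g, hginj⟩ ⟨y, fun i => ?_⟩
    have := (Finset.mem_filter.1 (f i).2).2
    simp only [Function.comp, Function.Embedding.coeFn_mk, hg]
    exact this
end

section
/- Let p ∈ (0, 1/2) and δ ∈ (0, 1 − H(p)), and set L = ⌈2/δ⌉. Then there exists n₀ such that for every n ≥ n₀ there is a code C ⊆ (Fin n → ZMod 2) with |C| ≥ 2^{n·(1 − H(p) − δ)} such that for every y ∈ (Fin n → ZMod 2), the number of codewords x ∈ C with hammingDist(x, y) ≤ p·n is at most L. (Achievability part of the list decoding capacity theorem for the adversarial bit-flip channel: rates up to 1 − H(p) − δ are attainable with list size O(1/δ).) -/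
open Finset

/-- The binary entropy function (in bits), with the convention `0·log₂ 0 = 0`
(inherited from `Real.logb 2 0 = 0`). -/
noncomputable def binEnt (q : ℝ) : ℝ :=
  -(q * Real.logb 2 q) - (1 - q) * Real.logb 2 (1 - q)


lemma aux_step {X : Type*} [Fintype X] [DecidableEq X] (B : X → X → Prop)
    [∀ x y, Decidable (B x y)] (V A : ℝ) (hA : 1 ≤ A) (hV0 : 0 ≤ V)
    (hV : ∀ y, (((Finset.univ.filter fun x => B x y).card : ℕ) : ℝ) ≤ V) (k : ℕ) :
    2 * k ≤ Fintype.card X → ∃ C : Finset X, C.card = k ∧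
      ∑ y, A ^ (C.filter fun x => B x y).card ≤
        (Fintype.card X : ℝ) * (1 + 2 * A * V / Fintype.card X) ^ k := by
  induction k with
  | zero =>
    intro _
    exact ⟨∅, by simp, by simp⟩
  | succ k ih =>
    intro hk
    obtain ⟨C, hC, hΦ⟩ := ih (by omega)
    have hcard : C.card + Cᶜ.card = Fintype.card X := Finset.card_add_card_compl C
    have hne : (Cᶜ).Nonempty := by
      rw [← Finset.card_pos]; omega
    set N : ℝ := (Fintype.card X : ℝ) with hN
    have hNpos : 0 < N := by
      rw [hN]; exact_mod_cast (by omega : 0 < Fintype.card X)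
    have hCc : N ≤ 2 * (Cᶜ.card : ℝ) := by
      rw [hN]; exact_mod_cast (by omega : Fintype.card X ≤ 2 * Cᶜ.card)
    set Φ : ℝ := ∑ y, A ^ (C.filter fun x => B x y).card with hΦdef
    have hA0 : 0 ≤ A := by linarith
    have hΦ0 : 0 ≤ Φ := Finset.sum_nonneg fun y _ => pow_nonneg hA0 _
    have hins : ∀ x ∈ Cᶜ, ∑ y, A ^ ((insert x C).filter fun x => B x y).card ≤
        Φ + ∑ y, A * A ^ (C.filter fun x => B x y).card * (if B x y then 1 else 0) := by
      intro x hx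
      rw [hΦdef, ← Finset.sum_add_distrib]
      refine Finset.sum_le_sum fun y _ => ?_
      have hx' : x ∉ C := by simpa using hx
      rw [Finset.filter_insert]
      split_ifs with h
      · rw [Finset.card_insert_of_notMem (by simp [hx']), pow_succ]
        have := pow_nonneg hA0 (C.filter fun x => B x y).card
        nlinarith
      · simp
    have hdouble : ∑ x ∈ Cᶜ, ∑ y, A * A ^ (C.filter fun x => B x y).card *
        (if B x y then (1 : ℝ) else 0) ≤ A * V * Φ := by
      rw [Finset.sum_comm, hΦdef, Finset.mul_sum]
      refine Finset.sum_le_sum fun y _ => ?_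
      rw [← Finset.mul_sum]
      have h1 : ∑ x ∈ Cᶜ, (if B x y then (1 : ℝ) else 0) ≤ V := by
        refine le_trans (Finset.sum_le_sum_of_subset_of_nonneg (Finset.subset_univ _) ?_) ?_
        · intro i _ _
          split_ifs <;> norm_num
        · refine le_trans (le_of_eq ?_) (hV y)
          simp
      have h2 : 0 ≤ A * A ^ (C.filter fun x => B x y).card := by positivity
      calc _ ≤ A * A ^ (C.filter fun x => B x y).card * V := mul_le_mul_of_nonneg_left h1 h2
        _ = _ := by ring
    have hsum : ∑ x ∈ Cᶜ, ∑ y, A ^ ((insert x C).filter fun x => B x y).card ≤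
        ∑ x ∈ Cᶜ, Φ * (1 + 2 * A * V / N) := by
      refine le_trans (Finset.sum_le_sum hins) ?_
      rw [Finset.sum_add_distrib, Finset.sum_const, Finset.sum_const, nsmul_eq_mul, nsmul_eq_mul]
      have h3 : A * V * Φ ≤ (Cᶜ.card : ℝ) * (Φ * (2 * A * V / N)) := by
        have : (Cᶜ.card : ℝ) * (Φ * (2 * A * V / N)) = (2 * Cᶜ.card / N) * (A * V * Φ) := by ring
        rw [this]
        have h4 : 1 ≤ 2 * (Cᶜ.card : ℝ) / N := by rwa [le_div_iff₀ hNpos, one_mul]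
        exact le_mul_of_one_le_left (by positivity) h4
      calc _ ≤ (Cᶜ.card : ℝ) * Φ + A * V * Φ := by gcongr
        _ ≤ (Cᶜ.card : ℝ) * Φ + (Cᶜ.card : ℝ) * (Φ * (2 * A * V / N)) := by gcongr
        _ = _ := by ring
    obtain ⟨x, hx, hle⟩ := Finset.exists_le_of_sum_le hne hsum
    refine ⟨insert x C, ?_, ?_⟩
    · rw [Finset.card_insert_of_notMem (by simpa using hx), hC]
    · refine hle.trans ?_
      rw [pow_succ, ← mul_assoc]
      have : 0 ≤ 1 + 2 * A * V / N := by positivity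
      exact mul_le_mul_of_nonneg_right hΦ this

lemma aux_binEnt_rpow (p : ℝ) (hp0 : 0 < p) (hp1 : p < 1) (n : ℝ) :
    (2 : ℝ) ^ (-(n * binEnt p)) = p ^ (p * n) * (1 - p) ^ (n - p * n) := by
  have hq : 0 < 1 - p := by linarith
  have e1 : (2 : ℝ) ^ (Real.logb 2 p) = p := Real.rpow_logb (by norm_num) (by norm_num) hp0
  have e2 : (2 : ℝ) ^ (Real.logb 2 (1 - p)) = 1 - p :=
    Real.rpow_logb (by norm_num) (by norm_num) hq
  have : -(n * binEnt p) = Real.logb 2 p * (p * n) + Real.logb 2 (1 - p) * (n - p * n) := by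
    unfold binEnt; ring
  rw [this, Real.rpow_add (by norm_num),
    Real.rpow_mul (by norm_num) (Real.logb 2 p) (p * n),
    Real.rpow_mul (by norm_num) (Real.logb 2 (1 - p)) (n - p * n), e1, e2]

lemma aux_ball (p : ℝ) (hp0 : 0 < p) (hp : p < 1 / 2) (n : ℕ) (y : Fin n → ZMod 2)
    [DecidablePred fun x : Fin n → ZMod 2 => (hammingDist x y : ℝ) ≤ p * (n : ℝ)] :
    (((Finset.univ.filter fun x : Fin n → ZMod 2 =>
      (hammingDist x y : ℝ) ≤ p * (n : ℝ)).card : ℕ) : ℝ) ≤ 2 ^ ((n : ℝ) * binEnt p) := by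
  have hq : 0 < 1 - p := by linarith
  have htot : ∑ x : Fin n → ZMod 2, ∏ i, (if x i ≠ y i then p else 1 - p) = 1 := by
    have h := Finset.prod_univ_sum (fun _ : Fin n => (Finset.univ : Finset (ZMod 2)))
      (fun i z => if z ≠ y i then p else 1 - p)
    rw [Fintype.piFinset_univ] at h
    rw [← h]
    refine Finset.prod_eq_one fun i _ => ?_
    have : ∀ a : ZMod 2, ∑ z : ZMod 2, (if z ≠ a then p else 1 - p) = 1 := by
      intro a
      have hu : (Finset.univ : Finset (ZMod 2)) = {0, 1} := rfl
      rw [hu, Finset.sum_pair (by decide)]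
      have ha : a = 0 ∨ a = 1 := by revert a; decide
      rcases ha with rfl | rfl <;> simp
    exact this (y i)
  have hterm : ∀ x : Fin n → ZMod 2, ∏ i, (if x i ≠ y i then p else 1 - p) =
      p ^ hammingDist x y * (1 - p) ^ (n - hammingDist x y) := by
    intro x
    rw [Finset.prod_ite, Finset.prod_const, Finset.prod_const]
    have h2 := Finset.card_filter_add_card_filter_not (s := (Finset.univ : Finset (Fin n)))
      (fun i => x i ≠ y i)
    rw [Finset.card_univ, Fintype.card_fin] at h2
    have h1 : (Finset.univ.filter fun i => x i ≠ y i).card = hammingDist x y := rfl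
    rw [h1] at h2 ⊢
    congr 2
    omega
  have hlow : ∀ x : Fin n → ZMod 2, (hammingDist x y : ℝ) ≤ p * n →
      (2 : ℝ) ^ (-((n : ℝ) * binEnt p)) ≤ ∏ i, (if x i ≠ y i then p else 1 - p) := by
    intro x hx
    have hd : hammingDist x y ≤ n := by
      simpa using hammingDist_le_card_fintype (x := x) (y := y)
    rw [hterm, aux_binEnt_rpow p hp0 (by linarith), ← Real.rpow_natCast, ← Real.rpow_natCast,
      Nat.cast_sub hd]
    set d : ℝ := (hammingDist x y : ℝ)
    have e1 : p ^ (p * (n : ℝ)) = p ^ d * p ^ (p * n - d) := by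
      rw [← Real.rpow_add hp0]; congr 1; ring
    have e2 : (1 - p) ^ ((n : ℝ) - d) = (1 - p) ^ (p * n - d) * (1 - p) ^ ((n : ℝ) - p * n) := by
      rw [← Real.rpow_add hq]; congr 1; ring
    rw [e1, e2, mul_assoc]
    have h3 : p ^ (p * n - d) ≤ (1 - p) ^ (p * n - d) :=
      Real.rpow_le_rpow hp0.le (by linarith) (by linarith)
    gcongr
  have hs : (((Finset.univ.filter fun x : Fin n → ZMod 2 =>
      (hammingDist x y : ℝ) ≤ p * (n : ℝ)).card : ℕ) : ℝ) * 2 ^ (-((n : ℝ) * binEnt p)) ≤ 1 := by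
    rw [← nsmul_eq_mul, ← Finset.sum_const, ← htot]
    refine le_trans (Finset.sum_le_sum (fun x hx => hlow x (Finset.mem_filter.1 hx).2)) ?_
    refine Finset.sum_le_sum_of_subset_of_nonneg (Finset.filter_subset _ _) ?_
    intro x _ _
    rw [hterm]; positivity
  rw [Real.rpow_neg (by norm_num), ← div_eq_mul_inv, div_le_one (by positivity)] at hs
  exact hs

open Classical in
/-- **Achievability part of the list decoding capacity theorem for the adversarial
bit-flip channel.** For `p ∈ (0, 1/2)` and `0 < δ < 1 − H(p)`, with list size
`L = ⌈2/δ⌉`, for all sufficiently large `n` there is a binary code of size at least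
`2^{n(1 − H(p) − δ)}` in which every Hamming ball of radius `p·n` contains at most
`L` codewords. -/
theorem list_decoding_capacity_achievability (p : ℝ) (hp0 : 0 < p) (hp : p < 1 / 2)
    (δ : ℝ) (hδ0 : 0 < δ) (hδ : δ < 1 - binEnt p) :
    ∃ n₀ : ℕ, ∀ n : ℕ, n₀ ≤ n →
      ∃ C : Finset (Fin n → ZMod 2),
        (2 : ℝ) ^ ((n : ℝ) * (1 - binEnt p - δ)) ≤ (C.card : ℝ) ∧
        ∀ y : Fin n → ZMod 2,
          (C.filter fun x => (hammingDist x y : ℝ) ≤ p * (n : ℝ)).card ≤ ⌈2 / δ⌉₊ := by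
  have hH0 : 0 ≤ binEnt p := by
    have h1 : Real.logb 2 p ≤ 0 := Real.logb_nonpos (by norm_num) hp0.le (by linarith)
    have h2 : Real.logb 2 (1 - p) ≤ 0 :=
      Real.logb_nonpos (by norm_num) (by linarith) (by linarith)
    unfold binEnt
    nlinarith
  refine ⟨max 8 ⌈2 / δ⌉₊, fun n hn => ?_⟩
  have hn8 : 8 ≤ n := le_trans (le_max_left _ _) hn
  have hnδ : 2 ≤ (n : ℝ) * δ := by
    have h1 : (⌈2 / δ⌉₊ : ℝ) ≤ n := by exact_mod_cast le_trans (le_max_right _ _) hn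
    have h2 := (Nat.le_ceil (2 / δ)).trans h1
    rwa [div_le_iff₀ hδ0] at h2
  have hn0 : (0 : ℝ) ≤ n := Nat.cast_nonneg n
  set H := binEnt p with hH
  set R : ℝ := (2 : ℝ) ^ ((n : ℝ) * (1 - H - δ)) with hR
  have hR1 : 1 ≤ R := Real.one_le_rpow (by norm_num) (mul_nonneg hn0 (by linarith))
  have hM2 : (⌈R⌉₊ : ℝ) ≤ 2 * R := by
    have := Nat.ceil_lt_add_one (show 0 ≤ R by linarith)
    linarith
  have hX : Fintype.card (Fin n → ZMod 2) = 2 ^ n := by simp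
  have hN : (Fintype.card (Fin n → ZMod 2) : ℝ) = (2 : ℝ) ^ (n : ℝ) := by
    rw [hX]; simp
  have hR4 : 4 * R ≤ (2 : ℝ) ^ (n : ℝ) := by
    have h4 : (4 : ℝ) = (2 : ℝ) ^ (2 : ℝ) := by norm_num
    rw [h4, hR, ← Real.rpow_add (by norm_num)]
    exact Real.rpow_le_rpow_of_exponent_le (by norm_num) (by nlinarith)
  have hMN : 2 * ⌈R⌉₊ ≤ Fintype.card (Fin n → ZMod 2) := by
    have : (2 * (⌈R⌉₊ : ℝ)) ≤ (Fintype.card (Fin n → ZMod 2) : ℝ) := by rw [hN]; linarith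
    exact_mod_cast this
  set A : ℝ := (2 : ℝ) ^ ((n : ℝ) * δ) with hAdef
  have hA : 1 ≤ A := Real.one_le_rpow (by norm_num) (by linarith)
  obtain ⟨C, hC, hΦ⟩ := aux_step
    (fun x y : Fin n → ZMod 2 => (hammingDist x y : ℝ) ≤ p * (n : ℝ))
    ((2 : ℝ) ^ ((n : ℝ) * H)) A hA (by positivity)
    (fun y => aux_ball p hp0 hp n y) ⌈R⌉₊ hMN
  refine ⟨C, ?_, fun y => ?_⟩
  · rw [hC]; exact Nat.le_ceil R
  by_contra hcon
  push Not at hcon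
  have hlow : A ^ (⌈2 / δ⌉₊ + 1) ≤
      ∑ y : Fin n → ZMod 2, A ^ (C.filter fun x => (hammingDist x y : ℝ) ≤ p * (n : ℝ)).card := by
    refine le_trans (pow_le_pow_right₀ hA hcon) ?_
    exact Finset.single_le_sum (f := fun y : Fin n → ZMod 2 =>
      A ^ (C.filter fun x => (hammingDist x y : ℝ) ≤ p * (n : ℝ)).card)
      (fun i _ => pow_nonneg (by linarith) _) (Finset.mem_univ y)
  have hA2 : (2 : ℝ) ^ (n : ℝ) * (2 : ℝ) ^ (n : ℝ) ≤ A ^ (⌈2 / δ⌉₊ + 1) := by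
    rw [hAdef, ← Real.rpow_natCast, ← Real.rpow_mul (by norm_num), ← Real.rpow_add (by norm_num)]
    refine Real.rpow_le_rpow_of_exponent_le (by norm_num) ?_
    push_cast
    have h2 := Nat.le_ceil (2 / δ)
    rw [div_le_iff₀ hδ0] at h2
    nlinarith
  have hup : (Fintype.card (Fin n → ZMod 2) : ℝ) *
      (1 + 2 * A * (2 : ℝ) ^ ((n : ℝ) * H) / Fintype.card (Fin n → ZMod 2)) ^ ⌈R⌉₊ ≤
      (2 : ℝ) ^ (n : ℝ) * Real.exp 4 := by
    rw [hN]
    set ε : ℝ := 2 * A * (2 : ℝ) ^ ((n : ℝ) * H) / (2 : ℝ) ^ (n : ℝ) with hε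
    have hε0 : 0 ≤ ε := by positivity
    have hεR : ε * R = 2 := by
      have : A * (2 : ℝ) ^ ((n : ℝ) * H) * R = (2 : ℝ) ^ (n : ℝ) := by
        rw [hAdef, hR, ← Real.rpow_add (by norm_num), ← Real.rpow_add (by norm_num)]
        congr 1; ring
      have hpos : (0 : ℝ) < (2 : ℝ) ^ (n : ℝ) := by positivity
      rw [hε, div_mul_eq_mul_div, div_eq_iff hpos.ne']
      linarith
    have h1 : (1 + ε) ^ ⌈R⌉₊ ≤ Real.exp 4 := by
      calc (1 + ε) ^ ⌈R⌉₊ ≤ (Real.exp ε) ^ ⌈R⌉₊ := by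
            gcongr
            have := Real.add_one_le_exp ε
            linarith
        _ = Real.exp (⌈R⌉₊ * ε) := by rw [← Real.exp_nat_mul]
        _ ≤ Real.exp 4 := by
            apply Real.exp_le_exp.2
            nlinarith
    gcongr
  have hexp : Real.exp 4 < (2 : ℝ) ^ (n : ℝ) := by
    have h1 : Real.exp 4 = Real.exp 1 ^ 4 := by rw [← Real.exp_nat_mul]; norm_num
    have h2 : Real.exp 1 ^ 4 < 3 ^ 4 :=
      pow_lt_pow_left₀ (by linarith [Real.exp_one_lt_d9]) (Real.exp_pos 1).le (by norm_num)
    have h3 : (2 : ℝ) ^ 8 ≤ 2 ^ n := pow_le_pow_right₀ (by norm_num) hn8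
    rw [Real.rpow_natCast, h1]
    norm_num at h2 h3
    linarith
  have hpos : (0 : ℝ) < (2 : ℝ) ^ (n : ℝ) := by positivity
  have hfin := (hA2.trans hlow).trans (hΦ.trans hup)
  exact absurd (le_of_mul_le_mul_left hfin hpos) (not_le.2 hexp)
end
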